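/- Let (M,g) be a proper second-order symmetric Brinkmann spacetime written in a Brinkmann chart, and consider the adapted null vector-field basis {e₀, e₁, e_i} in which e₀ is proportional to the parallel null vector field. Then the only possibly non-vanishing components of the covariant derivative of the curvature tensor in this basis are those of the form ∇₀R¹_{i0j}; in particular, all components of ∇R not of this form vanish identically. -/

import Mathlib

/-!
Core framework: coordinate tensor calculus on `ℝⁿ` (partial derivatives, Christoffel
symbols, Riemann curvature, iterated covariant derivatives `∇ʳR`), and a notion of
pseudo-Riemannian manifold given by an atlas of metric charts whose transition
functions are smooth isometries.
-/

noncomputable section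

open Matrix Set

/-- Partial derivative in the `i`-th coordinate direction. -/
def pd {n : ℕ} (i : Fin n) (f : (Fin n → ℝ) → ℝ) (x : Fin n → ℝ) : ℝ :=
  fderiv ℝ f x (Pi.single i 1)

/-- A metric in coordinates: a matrix-valued function on (an open subset of) `ℝⁿ`. -/
abbrev MetricMat (n : ℕ) := (Fin n → ℝ) → Matrix (Fin n) (Fin n) ℝ

/-- Christoffel symbols `Γ^k_{ij}` of a coordinate metric. -/
def christoffel {n : ℕ} (g : MetricMat n) (x : Fin n → ℝ) (k i j : Fin n) : ℝ :=
  (1 / 2) * ∑ l, (g x)⁻¹ k l *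
    (pd i (fun y => g y l j) x + pd j (fun y => g y l i) x - pd l (fun y => g y i j) x)

/-- Curvature tensor `R^l_{kij}` (1,3) of a coordinate metric. -/
def curvUp {n : ℕ} (g : MetricMat n) (x : Fin n → ℝ) (l k i j : Fin n) : ℝ :=
  pd i (fun y => christoffel g y l j k) x - pd j (fun y => christoffel g y l i k) x
    + ∑ m, christoffel g x l i m * christoffel g x m j k
    - ∑ m, christoffel g x l j m * christoffel g x m i k

/-- Covariant tensor fields of valence `s` in coordinates. -/
abbrev TensorField (n s : ℕ) := (Fin n → ℝ) → (Fin s → Fin n) → ℝ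

/-- The (0,4) Riemann curvature tensor `R_{lkij} = g_{lm} R^m_{kij}`. -/
def riemann {n : ℕ} (g : MetricMat n) : TensorField n 4 := fun x idx =>
  ∑ m, g x (idx 0) m * curvUp g x m (idx 1) (idx 2) (idx 3)

/-- The Ricci tensor `R_{ij} = R^m_{imj}`. -/
def ricci {n : ℕ} (g : MetricMat n) (x : Fin n → ℝ) (i j : Fin n) : ℝ :=
  ∑ m, curvUp g x m i m j

/-- Covariant derivative of a covariant tensor field; the new (derivative) index is slot `0`. -/
def covDeriv {n s : ℕ} (g : MetricMat n) (T : TensorField n s) : TensorField n (s + 1) :=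
  fun x idx =>
    pd (idx 0) (fun y => T y fun a => idx a.succ) x
      - ∑ a : Fin s, ∑ e, christoffel g x e (idx 0) (idx a.succ)
          * T x (Function.update (fun b : Fin s => idx b.succ) a e)

/-- Iterated covariant derivative `∇ʳ R` of the curvature tensor. -/
def nablaR {n : ℕ} (g : MetricMat n) : (r : ℕ) → TensorField n (4 + r)
  | 0 => riemann g
  | r + 1 => covDeriv g (nablaR g r)

/-- `∇ʳ R = 0` on `U` (`r`-th symmetry in coordinates). -/
def RthSymmetricOn {n : ℕ} (g : MetricMat n) (U : Set (Fin n → ℝ)) (r : ℕ) : Prop :=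
  ∀ x ∈ U, ∀ idx, nablaR g r x idx = 0

/-- Vanishing curvature (flatness) on `U`. -/
def FlatOn {n : ℕ} (g : MetricMat n) (U : Set (Fin n → ℝ)) : Prop :=
  ∀ x ∈ U, ∀ idx, riemann g x idx = 0

/-- A symmetric matrix is of Lorentzian signature `(-,+,…,+)` iff it is congruent to
`diag(-1,1,…,1)`. -/
def IsLorentzMat {n : ℕ} (A : Matrix (Fin n) (Fin n) ℝ) : Prop :=
  ∃ P : Matrix (Fin n) (Fin n) ℝ, IsUnit P.det ∧
    Pᵀ * A * P = Matrix.diagonal fun i : Fin n => if (i : ℕ) = 0 then (-1 : ℝ) else 1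

/-- `τ` is smooth on `S` and pulls the metric `g₂` back to the metric `g₁` there. -/
def IsPullbackIsometry {n m : ℕ} (g₁ : MetricMat n) (g₂ : MetricMat m)
    (τ : (Fin n → ℝ) → Fin m → ℝ) (S : Set (Fin n → ℝ)) : Prop :=
  (∀ a : Fin m, ContDiffOn ℝ (⊤ : ℕ∞) (fun y => τ y a) S) ∧
  ∀ x ∈ S, ∀ i j : Fin n,
    g₁ x i j = ∑ a, ∑ b, g₂ (τ x) a b * pd i (fun y => τ y a) x * pd j (fun y => τ y b) x

/-- A metric chart on a topological space `M`: a homeomorphism of an open set of `M` onto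
an open set of `ℝⁿ`, together with the coordinate expression of the metric tensor. -/
structure MetricChart (n : ℕ) (M : Type) [TopologicalSpace M] where
  dom : Set M
  open_dom : IsOpen dom
  φ : M → Fin n → ℝ
  ψ : (Fin n → ℝ) → M
  ran : Set (Fin n → ℝ)
  open_ran : IsOpen ran
  maps_to : ∀ p ∈ dom, φ p ∈ ran
  maps_from : ∀ x ∈ ran, ψ x ∈ dom
  left_inv : ∀ p ∈ dom, ψ (φ p) = p
  right_inv : ∀ x ∈ ran, φ (ψ x) = x
  cont_phi : ContinuousOn φ dom
  cont_psi : ContinuousOn ψ ran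
  g : MetricMat n
  smooth_g : ∀ a b : Fin n, ContDiffOn ℝ (⊤ : ℕ∞) (fun x => g x a b) ran
  symm_g : ∀ x ∈ ran, (g x).IsSymm
  nondeg_g : ∀ x ∈ ran, IsUnit (g x).det

/-- An `n`-dimensional pseudo-Riemannian manifold: a topological space covered by metric
charts whose transition functions are (smooth) isometries for the chart metrics. -/
structure PRManifold (n : ℕ) where
  M : Type
  top : TopologicalSpace M
  chartAt : M → @MetricChart n M top
  mem_chart : ∀ p : M, p ∈ (chartAt p).dom
  compatible : ∀ p q : M,
    IsPullbackIsometry (chartAt p).g (chartAt q).g ((chartAt q).φ ∘ (chartAt p).ψ)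
      ((chartAt p).φ '' ((chartAt p).dom ∩ (chartAt q).dom))

attribute [instance] PRManifold.top

namespace PRManifold

variable {n : ℕ}

/-- The metric is Lorentzian, of signature `(-,+,…,+)`. -/
def IsLorentzian (X : PRManifold n) : Prop :=
  ∀ p : X.M, ∀ x ∈ (X.chartAt p).ran, IsLorentzMat ((X.chartAt p).g x)

/-- The metric is Riemannian (positive definite). -/
def IsRiemannian (X : PRManifold n) : Prop :=
  ∀ p : X.M, ∀ x ∈ (X.chartAt p).ran, ((X.chartAt p).g x).PosDef

/-- Connectedness of the underlying space. -/
def Conn (X : PRManifold n) : Prop := ConnectedSpace X.M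

/-- Simple connectedness of the underlying space. -/
def SimplyConn (X : PRManifold n) : Prop := SimplyConnectedSpace X.M

/-- `∇ʳ R = 0` (in every chart). -/
def RthSymmetric (X : PRManifold n) (r : ℕ) : Prop :=
  ∀ p : X.M, RthSymmetricOn (X.chartAt p).g (X.chartAt p).ran r

/-- `∇ʳ R = 0` but `∇^{r-1} R ≠ 0`. -/
def ProperRthSymmetric (X : PRManifold n) (r : ℕ) : Prop :=
  X.RthSymmetric r ∧ ¬ X.RthSymmetric (r - 1)

/-- The curvature tensor vanishes identically. -/
def Flat (X : PRManifold n) : Prop :=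
  ∀ p : X.M, FlatOn (X.chartAt p).g (X.chartAt p).ran

/-- The Ricci tensor vanishes identically. -/
def RicciFlat (X : PRManifold n) : Prop :=
  ∀ p : X.M, ∀ x ∈ (X.chartAt p).ran, ∀ i j, ricci (X.chartAt p).g x i j = 0

end PRManifold

/-- A curve `c` (written in coordinates) is a geodesic of `g` on the parameter set `I`:
its components are twice differentiable and satisfy the geodesic equations. -/
def IsGeodesicCurve {n : ℕ} (g : MetricMat n) (I : Set ℝ) (c : ℝ → Fin n → ℝ) : Prop :=
  ∀ t ∈ I, ∀ k : Fin n,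
    DifferentiableAt ℝ (fun s => c s k) t ∧
    DifferentiableAt ℝ (deriv fun s => c s k) t ∧
    deriv (deriv fun s => c s k) t
      + ∑ i, ∑ j, christoffel g (c t) k i j * deriv (fun s => c s i) t
          * deriv (fun s => c s j) t = 0

namespace PRManifold

variable {n : ℕ}

/-- `γ` is a geodesic of `X` on the parameter set `I`: around each parameter it lies in a
chart and its coordinate expression solves the geodesic equations there. -/
def IsGeodesic (X : PRManifold n) (I : Set ℝ) (γ : ℝ → X.M) : Prop :=
  ∀ t ∈ I, ∃ p : X.M, ∃ ε > (0 : ℝ),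
    (∀ s ∈ I ∩ Set.Ioo (t - ε) (t + ε), γ s ∈ (X.chartAt p).dom) ∧
    IsGeodesicCurve (X.chartAt p).g (I ∩ Set.Ioo (t - ε) (t + ε))
      (fun s => (X.chartAt p).φ (γ s))

/-- Geodesic completeness: every (nontrivial) geodesic defined on an open interval
extends to a geodesic defined on all of `ℝ`. -/
def GeodesicallyComplete (X : PRManifold n) : Prop :=
  ∀ (a b : ℝ) (γ : ℝ → X.M), (Set.Ioo a b).Nonempty → X.IsGeodesic (Set.Ioo a b) γ →
    ∃ γ' : ℝ → X.M, X.IsGeodesic Set.univ γ' ∧ ∀ t ∈ Set.Ioo a b, γ' t = γ t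

end PRManifold

/-- First block of coordinates of a product. -/
def split1 {n₁ n₂ : ℕ} (x : Fin (n₁ + n₂) → ℝ) : Fin n₁ → ℝ := fun i => x (Fin.castAdd n₂ i)

/-- Second block of coordinates of a product. -/
def split2 {n₁ n₂ : ℕ} (x : Fin (n₁ + n₂) → ℝ) : Fin n₂ → ℝ := fun j => x (Fin.natAdd n₁ j)

/-- The direct-product (block diagonal) metric `g₁ ⊕ g₂` in coordinates. -/
def prodMetricMat {n₁ n₂ : ℕ} (G₁ : MetricMat n₁) (G₂ : MetricMat n₂) :
    MetricMat (n₁ + n₂) := fun x =>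
  (Matrix.fromBlocks (G₁ (split1 x)) 0 0 (G₂ (split2 x))).submatrix
    finSumFinEquiv.symm finSumFinEquiv.symm

/-- The (generalized Cahen–Wallach / plane-wave) metric
`g = -2du(dv + P_{ij}(u)xⁱxʲ du) + δ_{ij} dxⁱ dxʲ` on `ℝ^{e+2}`,
with coordinates `x 0 = u`, `x 1 = v` and spatial coordinates `x i.succ.succ`. -/
def cwMetric (e : ℕ) (P : ℝ → Matrix (Fin e) (Fin e) ℝ) : MetricMat (e + 2) := fun x k l =>
  (if k = 0 ∧ l = 0 then (-2) * ∑ i, ∑ j, P (x 0) i j * x i.succ.succ * x j.succ.succ else 0)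
  + (if (k = 0 ∧ l = 1) ∨ (k = 1 ∧ l = 0) then -1 else 0)
  + (if k = l ∧ 2 ≤ (k : ℕ) then 1 else 0)

/-- The Brinkmann metric `ds² = -2du(dv + H du + Wᵢ dxⁱ) + g_{ij} dxⁱ dxʲ` on `ℝ^{d+2}`,
with coordinates `x 0 = u`, `x 1 = v` and spatial coordinates `x i.succ.succ`. -/
def brinkmannMat (d : ℕ) (H : (Fin (d + 2) → ℝ) → ℝ) (W : Fin d → (Fin (d + 2) → ℝ) → ℝ)
    (gs : (Fin (d + 2) → ℝ) → Matrix (Fin d) (Fin d) ℝ) : MetricMat (d + 2) := fun x k l =>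
  (if k = 0 ∧ l = 0 then (-2) * H x else 0)
  + (if (k = 0 ∧ l = 1) ∨ (k = 1 ∧ l = 0) then -1 else 0)
  + (if k = 0 then ∑ i : Fin d, if l = i.succ.succ then -(W i x) else 0 else 0)
  + (if l = 0 then ∑ i : Fin d, if k = i.succ.succ then -(W i x) else 0 else 0)
  + ∑ i : Fin d, ∑ j : Fin d, if k = i.succ.succ ∧ l = j.succ.succ then gs x i j else 0

/-- A function on `ℝ^{d+2}` is independent of the coordinate `v = x 1`. -/
def vIndep {d : ℕ} {α : Type*} (f : (Fin (d + 2) → ℝ) → α) : Prop :=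
  ∀ x t, f (Function.update x (1 : Fin (d + 2)) t) = f x

/-- The point of `ℝ^{d+2}` with `u`, `v` and spatial coordinates `u`, `v`, `y`. -/
def emb (d : ℕ) (u v : ℝ) (y : Fin d → ℝ) : Fin (d + 2) → ℝ :=
  Fin.cons u (Fin.cons v y)
-- extension layer (appended to core for testing)
namespace PRManifold

variable {n : ℕ}

/-- A self-map of `Y` is a (global) isometry: it is a homeomorphism and, read in the
charts, it pulls the metric back to the metric. -/
def IsAutoIsometry (Y : PRManifold n) (σ : Y.M → Y.M) : Prop :=
  Function.Bijective σ ∧ Continuous σ ∧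
    ∀ q : Y.M, ∃ S, IsOpen S ∧ (Y.chartAt q).φ q ∈ S ∧ S ⊆ (Y.chartAt q).ran ∧
      (∀ x ∈ S, σ ((Y.chartAt q).ψ x) ∈ (Y.chartAt (σ q)).dom) ∧
      IsPullbackIsometry (Y.chartAt q).g (Y.chartAt (σ q)).g
        (fun x => (Y.chartAt (σ q)).φ (σ ((Y.chartAt q).ψ x))) S

/-- `Y` is a (globally) symmetric space: the geodesic symmetry at every point extends to
a global isometry, i.e. every point is an isolated fixed point of a global isometry whose
differential there is `-id` (in chart coordinates). -/
def IsSymmetricSpace (Y : PRManifold n) : Prop :=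
  ∀ q : Y.M, ∃ σ : Y.M → Y.M, Y.IsAutoIsometry σ ∧ σ q = q ∧
    ∀ a i : Fin n,
      pd i (fun x => (Y.chartAt (σ q)).φ (σ ((Y.chartAt q).ψ x)) a) ((Y.chartAt q).φ q)
        = -(if i = a then 1 else 0)

/-- The metric of `X` is real-analytic: around every point there are coordinates in which
the metric components are real-analytic functions. -/
def AnalyticMetric (X : PRManifold n) : Prop :=
  ∀ p : X.M, ∃ S, IsOpen S ∧ (X.chartAt p).φ p ∈ S ∧ S ⊆ (X.chartAt p).ran ∧
    ∃ (τ : (Fin n → ℝ) → Fin n → ℝ) (G : MetricMat n),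
      Set.InjOn τ S ∧ (∀ a b : Fin n, AnalyticOnNhd ℝ (fun y => G y a b) (τ '' S)) ∧
      IsPullbackIsometry (X.chartAt p).g G τ S

end PRManifold

/-- `Z` is globally isometric to the direct product `X × Y` (with the product metric):
there is a bijection which, read in charts, is an isometry onto the product. -/
def GloballyIsometricToProd {n₀ n₁ n₂ : ℕ} (Z : PRManifold n₀)
    (X : PRManifold n₁) (Y : PRManifold n₂) : Prop :=
  ∃ F : Z.M → X.M × Y.M, Function.Bijective F ∧
    ∀ p : Z.M, ∃ S, IsOpen S ∧ (Z.chartAt p).φ p ∈ S ∧ S ⊆ (Z.chartAt p).ran ∧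
      (∀ x ∈ S, (F ((Z.chartAt p).ψ x)).1 ∈ (X.chartAt (F p).1).dom
        ∧ (F ((Z.chartAt p).ψ x)).2 ∈ (Y.chartAt (F p).2).dom) ∧
      IsPullbackIsometry (Z.chartAt p).g
        (prodMetricMat (X.chartAt (F p).1).g (Y.chartAt (F p).2).g)
        (fun x => Fin.append ((X.chartAt (F p).1).φ (F ((Z.chartAt p).ψ x)).1)
          ((Y.chartAt (F p).2).φ (F ((Z.chartAt p).ψ x)).2)) S

/-- `X` is globally isometric to the direct product of the coordinate spacetime
`(ℝ^{e+2}, Gcw)` and `Y` (with the product metric). -/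
def GloballyIsometricToCWProd {n e m : ℕ} (X : PRManifold n) (Gcw : MetricMat (e + 2))
    (Y : PRManifold m) : Prop :=
  ∃ F : X.M → (Fin (e + 2) → ℝ) × Y.M, Function.Bijective F ∧
    ∀ p : X.M, ∃ S, IsOpen S ∧ (X.chartAt p).φ p ∈ S ∧ S ⊆ (X.chartAt p).ran ∧
      (∀ x ∈ S, (F ((X.chartAt p).ψ x)).2 ∈ (Y.chartAt (F p).2).dom) ∧
      IsPullbackIsometry (X.chartAt p).g (prodMetricMat Gcw (Y.chartAt (F p).2).g)
        (fun x => Fin.append (F ((X.chartAt p).ψ x)).1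
          ((Y.chartAt (F p).2).φ (F ((X.chartAt p).ψ x)).2)) S

/-- `X` is locally isometric to the direct product of the coordinate spacetime
`(ℝ^{e+2}, Gcw)` and `Y`: every point has a neighbourhood that maps isometrically into
the product. -/
def LocallyIsometricToCWProd {n e m : ℕ} (X : PRManifold n) (Gcw : MetricMat (e + 2))
    (Y : PRManifold m) : Prop :=
  ∀ p : X.M, ∃ q : Y.M, ∃ S, IsOpen S ∧ (X.chartAt p).φ p ∈ S ∧ S ⊆ (X.chartAt p).ran ∧
    ∃ τ : (Fin n → ℝ) → Fin ((e + 2) + m) → ℝ,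
      (∀ x ∈ S, split2 (n₁ := e + 2) (τ x) ∈ (Y.chartAt q).ran) ∧
      IsPullbackIsometry (X.chartAt p).g (prodMetricMat Gcw (Y.chartAt q).g) τ S

/-- An identification of `Σ i, Fin (m i)` with `Fin (∑ i, m i)`. -/
def sigmaFinEquiv {k : ℕ} (m : Fin k → ℕ) : (Σ i : Fin k, Fin (m i)) ≃ Fin (∑ i, m i) :=
  (Fintype.equivFin _).trans (finCongr (by simp))

/-- The `i`-th block of coordinates in `ℝ^{∑ mdim}`. -/
def sigCoord {k : ℕ} {mdim : Fin k → ℕ} (x : Fin (∑ i, mdim i) → ℝ) (i : Fin k) :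
    Fin (mdim i) → ℝ := fun a => x (sigmaFinEquiv mdim ⟨i, a⟩)

/-- The block-diagonal metric of a finite direct product, in coordinates. -/
def multiBlockMetric {k : ℕ} {mdim : Fin k → ℕ}
    (G : (i : Fin k) → MetricMat (mdim i)) : MetricMat (∑ i, mdim i) := fun x a b =>
  let sa := (sigmaFinEquiv mdim).symm a
  let sb := (sigmaFinEquiv mdim).symm b
  if h : sa.1 = sb.1 then G sb.1 (sigCoord x sb.1) (h ▸ sa.2) sb.2 else 0

/-- `X` is globally isometric to the direct product of the coordinate spacetime
`(ℝ^d, Gcw)` with the finite family of manifolds `Y i` (with the product metric). -/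
def GloballyIsometricToCWMultiProd {n d k : ℕ} {mdim : Fin k → ℕ}
    (X : PRManifold n) (Gcw : MetricMat d)
    (Y : (i : Fin k) → PRManifold (mdim i)) : Prop :=
  ∃ F : X.M → (Fin d → ℝ) × ((i : Fin k) → (Y i).M), Function.Bijective F ∧
    ∀ p : X.M, ∃ S, IsOpen S ∧ (X.chartAt p).φ p ∈ S ∧ S ⊆ (X.chartAt p).ran ∧
      (∀ x ∈ S, ∀ i, (F ((X.chartAt p).ψ x)).2 i ∈ ((Y i).chartAt ((F p).2 i)).dom) ∧
      IsPullbackIsometry (X.chartAt p).g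
        (prodMetricMat Gcw (multiBlockMetric fun i => ((Y i).chartAt ((F p).2 i)).g))
        (fun x => Fin.append (F ((X.chartAt p).ψ x)).1
          (fun j => let s := (sigmaFinEquiv mdim).symm j
            ((Y s.1).chartAt ((F p).2 s.1)).φ ((F ((X.chartAt p).ψ x)).2 s.1) s.2)) S

/-- `X` is locally isometric to the direct product of the coordinate spacetime
`(ℝ^d, Gcw)` with the finite family of manifolds `Y i`. -/
def LocallyIsometricToCWMultiProd {n d k : ℕ} {mdim : Fin k → ℕ}
    (X : PRManifold n) (Gcw : MetricMat d)
    (Y : (i : Fin k) → PRManifold (mdim i)) : Prop :=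
  ∀ p : X.M, ∃ q : (i : Fin k) → (Y i).M, ∃ S, IsOpen S ∧ (X.chartAt p).φ p ∈ S ∧
    S ⊆ (X.chartAt p).ran ∧
    ∃ τ : (Fin n → ℝ) → Fin (d + ∑ i, mdim i) → ℝ,
      (∀ x ∈ S, ∀ i : Fin k,
        sigCoord (split2 (n₁ := d) (τ x)) i ∈ ((Y i).chartAt (q i)).ran) ∧
      IsPullbackIsometry (X.chartAt p).g
        (prodMetricMat Gcw (multiBlockMetric fun i => ((Y i).chartAt (q i)).g)) τ S

/-- `X'` (with projection `π`) is a universal covering of `X`, with the pulled-back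
metric: `π` is a topological covering map, `X'` is simply connected and `π` is a local
isometry. -/
def IsUniversalCoverOf {n : ℕ} (X' X : PRManifold n) (π : X'.M → X.M) : Prop :=
  IsCoveringMap π ∧ X'.SimplyConn ∧
    ∀ p : X'.M, ∃ S, IsOpen S ∧ (X'.chartAt p).φ p ∈ S ∧ S ⊆ (X'.chartAt p).ran ∧
      (∀ x ∈ S, π ((X'.chartAt p).ψ x) ∈ (X.chartAt (π p)).dom) ∧
      IsPullbackIsometry (X'.chartAt p).g (X.chartAt (π p)).g
        (fun x => (X.chartAt (π p)).φ (π ((X'.chartAt p).ψ x))) S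

/-- The value of the metric on a pair of tangent vectors, in coordinates. -/
def gApply {n : ℕ} (g : MetricMat n) (x v w : Fin n → ℝ) : ℝ :=
  ∑ k, ∑ l, g x k l * v k * w l

/-- The Gram matrix of an adapted null frame `{e₀, e₁, eᵢ}`: `g(e₀,e₁) = -1`,
`e₀, e₁` null, `{eᵢ}` orthonormal and orthogonal to `e₀, e₁`. -/
def nullFrameGram (d : ℕ) : Matrix (Fin (d + 2)) (Fin (d + 2)) ℝ := fun a b =>
  (if (a = 0 ∧ b = 1) ∨ (a = 1 ∧ b = 0) then -1 else 0)
  + (if a = b ∧ 2 ≤ (a : ℕ) then 1 else 0)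

/-- The components of `∇R` in a frame `E` (frame vector fields written in coordinates):
the fully covariant tensor `∇R` evaluated on the frame vectors `E (a 0), …, E (a 4)`
(slot `0` is the derivative slot). -/
def frameComp5 {n : ℕ} (g : MetricMat n) (E : Fin n → (Fin n → ℝ) → Fin n → ℝ)
    (x : Fin n → ℝ) (a : Fin 5 → Fin n) : ℝ :=
  ∑ μ : Fin 5 → Fin n, nablaR g 1 x μ * ∏ t, E (a t) x (μ t)

/-- Smoothness of a scalar function on a set. -/
abbrev SmoothOn {n : ℕ} (U : Set (Fin n → ℝ)) (f : (Fin n → ℝ) → ℝ) : Prop :=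
  ContDiffOn ℝ (⊤ : ℕ∞) f U

section Calculus

variable {n : ℕ} {U : Set (Fin n → ℝ)} {f f' : (Fin n → ℝ) → ℝ} {x : Fin n → ℝ}

theorem SmoothOn.differentiableAt (hf : SmoothOn U f) (hU : IsOpen U) (hx : x ∈ U) :
    DifferentiableAt ℝ f x :=
  (hf.contDiffAt (hU.mem_nhds hx)).differentiableAt (by simp)

theorem SmoothOn.pd (hf : SmoothOn U f) (hU : IsOpen U) (i : Fin n) : SmoothOn U (pd i f) :=
  (hf.fderiv_of_isOpen hU (m := (⊤ : ℕ∞)) (by simp)).clm_apply contDiffOn_const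

theorem pd_congr (hU : IsOpen U) (h : ∀ y ∈ U, f y = f' y) (hx : x ∈ U) (i : Fin n) :
    pd i f x = pd i f' x := by
  unfold pd
  rw [Filter.EventuallyEq.fderiv_eq (Filter.eventually_of_mem (hU.mem_nhds hx) h)]

theorem pd_eq_zero_of_eqOn (hU : IsOpen U) (h : ∀ y ∈ U, f y = 0) (hx : x ∈ U) (i : Fin n) :
    pd i f x = 0 := by
  rw [pd_congr hU h hx i]; simp [pd]

theorem pd_add (hf : DifferentiableAt ℝ f x) (hf' : DifferentiableAt ℝ f' x) (i : Fin n) :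
    pd i (fun y => f y + f' y) x = pd i f x + pd i f' x := by
  simp [pd, fderiv_fun_add hf hf']

theorem pd_sub (hf : DifferentiableAt ℝ f x) (hf' : DifferentiableAt ℝ f' x) (i : Fin n) :
    pd i (fun y => f y - f' y) x = pd i f x - pd i f' x := by
  simp [pd, fderiv_fun_sub hf hf']

theorem pd_mul (hf : DifferentiableAt ℝ f x) (hf' : DifferentiableAt ℝ f' x) (i : Fin n) :
    pd i (fun y => f y * f' y) x = pd i f x * f' x + f x * pd i f' x := by
  simp [pd, fderiv_fun_mul hf hf']; ring

theorem pd_sum {ι : Type*} (s : Finset ι) {F : ι → (Fin n → ℝ) → ℝ}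
    (h : ∀ j ∈ s, DifferentiableAt ℝ (F j) x) (i : Fin n) :
    pd i (fun y => ∑ j ∈ s, F j y) x = ∑ j ∈ s, pd i (F j) x := by
  simp [pd, fderiv_fun_sum h]

theorem pd_comm (hf : SmoothOn U f) (hU : IsOpen U) (hx : x ∈ U) (i j : Fin n) :
    pd i (pd j f) x = pd j (pd i f) x := by
  have hd : DifferentiableAt ℝ (fderiv ℝ f) x :=
    ((hf.fderiv_of_isOpen hU (m := (⊤ : ℕ∞)) (by simp)).contDiffAt
      (hU.mem_nhds hx)).differentiableAt (by simp)
  have hs : IsSymmSndFDerivAt ℝ f x :=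
    (hf.contDiffAt (hU.mem_nhds hx)).isSymmSndFDerivAt
      (by rw [minSmoothness_of_isRCLikeNormedField]; exact WithTop.coe_le_coe.2 le_top)
  have key : ∀ a b : Fin n,
      pd a (pd b f) x = fderiv ℝ (fderiv ℝ f) x (Pi.single a 1) (Pi.single b 1) := by
    intro a b
    change fderiv ℝ (fun y => fderiv ℝ f y (Pi.single b 1)) x (Pi.single a 1) = _
    rw [fderiv_clm_apply hd (differentiableAt_const _)]
    simp
  rw [key, key]
  exact hs _ _

end Calculus

section MatrixFields

variable {n : ℕ} {U : Set (Fin n → ℝ)} {A B : MetricMat n} {x : Fin n → ℝ}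

/-- Entrywise smoothness of a matrix field. -/
def MatSmoothOn (U : Set (Fin n → ℝ)) (A : MetricMat n) : Prop :=
  ∀ a b, SmoothOn U fun x => A x a b

/-- Entrywise partial derivative of a matrix field. -/
def matPd (i : Fin n) (A : MetricMat n) : MetricMat n :=
  fun x => Matrix.of fun a b => pd i (fun y => A y a b) x

@[simp] theorem matPd_apply (i : Fin n) (A : MetricMat n) (x : Fin n → ℝ) (a b : Fin n) :
    matPd i A x a b = pd i (fun y => A y a b) x := rfl

theorem MatSmoothOn.matPd (hA : MatSmoothOn U A) (hU : IsOpen U) (i : Fin n) :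
    MatSmoothOn U (matPd i A) := fun a b => (hA a b).pd hU i

theorem MatSmoothOn.add (hA : MatSmoothOn U A) (hB : MatSmoothOn U B) :
    MatSmoothOn U (fun x => A x + B x) := fun a b => ContDiffOn.add (hA a b) (hB a b)

theorem MatSmoothOn.sub (hA : MatSmoothOn U A) (hB : MatSmoothOn U B) :
    MatSmoothOn U (fun x => A x - B x) := fun a b => ContDiffOn.sub (hA a b) (hB a b)

theorem MatSmoothOn.transpose (hA : MatSmoothOn U A) : MatSmoothOn U (fun x => (A x)ᵀ) :=
  fun a b => hA b a

theorem MatSmoothOn.mul (hA : MatSmoothOn U A) (hB : MatSmoothOn U B) :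
    MatSmoothOn U (fun x => A x * B x) := fun a b => by
  simp only [Matrix.mul_apply]
  exact ContDiffOn.sum fun m _ => (hA a m).mul (hB m b)

theorem MatSmoothOn.det (hA : MatSmoothOn U A) : SmoothOn U fun x => (A x).det := by
  simp only [Matrix.det_apply, Units.smul_def, zsmul_eq_mul]
  exact ContDiffOn.sum fun σ _ => contDiffOn_const.mul (contDiffOn_prod fun i _ => hA _ _)

theorem MatSmoothOn.inv (hA : MatSmoothOn U A) (hdet : ∀ x ∈ U, IsUnit (A x).det) :
    MatSmoothOn U (fun x => (A x)⁻¹) := fun a b => by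
  simp only [Matrix.inv_def, Ring.inverse_eq_inv', Matrix.smul_apply, smul_eq_mul,
    Matrix.adjugate_apply]
  refine ContDiffOn.mul (hA.det.inv fun x hx => (hdet x hx).ne_zero) ?_
  refine MatSmoothOn.det fun c e => ?_
  by_cases h : c = b
  · subst h; simpa using contDiffOn_const
  · simpa [Matrix.updateRow_apply, h] using hA c e

theorem matPd_congr (hU : IsOpen U) (h : ∀ y ∈ U, A y = B y) (hx : x ∈ U) (i : Fin n) :
    matPd i A x = matPd i B x := by
  ext a b; exact pd_congr hU (fun y hy => by rw [h y hy]) hx i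

theorem matPd_add (hU : IsOpen U) (hA : MatSmoothOn U A) (hB : MatSmoothOn U B) (hx : x ∈ U)
    (i : Fin n) : matPd i (fun y => A y + B y) x = matPd i A x + matPd i B x := by
  ext a b
  exact pd_add ((hA a b).differentiableAt hU hx) ((hB a b).differentiableAt hU hx) i

theorem matPd_sub (hU : IsOpen U) (hA : MatSmoothOn U A) (hB : MatSmoothOn U B) (hx : x ∈ U)
    (i : Fin n) : matPd i (fun y => A y - B y) x = matPd i A x - matPd i B x := by
  ext a b
  exact pd_sub ((hA a b).differentiableAt hU hx) ((hB a b).differentiableAt hU hx) i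

theorem matPd_mul (hU : IsOpen U) (hA : MatSmoothOn U A) (hB : MatSmoothOn U B) (hx : x ∈ U)
    (i : Fin n) : matPd i (fun y => A y * B y) x = matPd i A x * B x + A x * matPd i B x := by
  ext a b
  simp only [matPd_apply, Matrix.mul_apply, Matrix.add_apply, ← Finset.sum_add_distrib]
  refine (pd_sum (F := fun m y => A y a m * B y m b) _ (fun m _ =>
    DifferentiableAt.fun_mul ((hA a m).differentiableAt hU hx)
      ((hB m b).differentiableAt hU hx)) i).trans ?_
  exact Finset.sum_congr rfl fun m _ =>
    pd_mul ((hA a m).differentiableAt hU hx) ((hB m b).differentiableAt hU hx) i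

theorem matPd_transpose (i : Fin n) : matPd i (fun y => (A y)ᵀ) x = (matPd i A x)ᵀ := rfl

theorem matPd_comm (hU : IsOpen U) (hA : MatSmoothOn U A) (hx : x ∈ U) (i j : Fin n) :
    matPd i (matPd j A) x = matPd j (matPd i A) x := by
  ext a b; exact pd_comm (hA a b) hU hx i j

end MatrixFields

section SlotAction

variable {n s : ℕ}

/-- The derivation action of a matrix on covariant tensor components, slot by slot. -/
def slotAct (A : Matrix (Fin n) (Fin n) ℝ) (X : (Fin s → Fin n) → ℝ) (idx : Fin s → Fin n) : ℝ :=
  ∑ a, ∑ e, A e (idx a) * X (Function.update idx a e)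

theorem slotAct_add_left (A B : Matrix (Fin n) (Fin n) ℝ) (X : (Fin s → Fin n) → ℝ) :
    slotAct (A + B) X = slotAct A X + slotAct B X := by
  ext idx; simp [slotAct, add_mul, Finset.sum_add_distrib]

theorem slotAct_sub_left (A B : Matrix (Fin n) (Fin n) ℝ) (X : (Fin s → Fin n) → ℝ) :
    slotAct (A - B) X = slotAct A X - slotAct B X := by
  ext idx; simp [slotAct, sub_mul, Finset.sum_sub_distrib]

theorem slotAct_smul_left (c : ℝ) (A : Matrix (Fin n) (Fin n) ℝ) (X : (Fin s → Fin n) → ℝ) :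
    slotAct (c • A) X = c • slotAct A X := by
  ext idx; simp [slotAct, mul_assoc, Finset.mul_sum]

theorem slotAct_sum_left {ι : Type*} (t : Finset ι) (A : ι → Matrix (Fin n) (Fin n) ℝ)
    (X : (Fin s → Fin n) → ℝ) :
    slotAct (∑ j ∈ t, A j) X = ∑ j ∈ t, slotAct (A j) X := by
  classical
  induction t using Finset.induction_on with
  | empty => ext idx; simp [slotAct]
  | insert j t hj ih => rw [Finset.sum_insert hj, Finset.sum_insert hj, slotAct_add_left, ih]

theorem slotAct_add_right (A : Matrix (Fin n) (Fin n) ℝ) (X Y : (Fin s → Fin n) → ℝ) :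
    slotAct A (X + Y) = slotAct A X + slotAct A Y := by
  ext idx; simp [slotAct, mul_add, Finset.sum_add_distrib]

theorem slotAct_sub_right (A : Matrix (Fin n) (Fin n) ℝ) (X Y : (Fin s → Fin n) → ℝ) :
    slotAct A (X - Y) = slotAct A X - slotAct A Y := by
  ext idx; simp [slotAct, mul_sub, Finset.sum_sub_distrib]

theorem slotAct_smul_right (c : ℝ) (A : Matrix (Fin n) (Fin n) ℝ) (X : (Fin s → Fin n) → ℝ) :
    slotAct A (c • X) = c • slotAct A X := by
  ext idx; simp [slotAct, Finset.mul_sum, mul_left_comm]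

theorem slotAct_zero_right (A : Matrix (Fin n) (Fin n) ℝ) :
    slotAct A (0 : (Fin s → Fin n) → ℝ) = 0 := by
  ext idx; simp [slotAct]

theorem slotAct_sum_right {ι : Type*} (t : Finset ι) (A : Matrix (Fin n) (Fin n) ℝ)
    (X : ι → (Fin s → Fin n) → ℝ) :
    slotAct A (∑ j ∈ t, X j) = ∑ j ∈ t, slotAct A (X j) := by
  classical
  induction t using Finset.induction_on with
  | empty => simp [slotAct_zero_right]
  | insert j t hj ih => rw [Finset.sum_insert hj, Finset.sum_insert hj, slotAct_add_right, ih]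

/-- The slot action reverses commutators. -/
theorem slotAct_commutator (A B : Matrix (Fin n) (Fin n) ℝ) (X : (Fin s → Fin n) → ℝ) :
    slotAct A (slotAct B X) - slotAct B (slotAct A X) = slotAct (B * A - A * B) X := by
  have expand : ∀ (A B : Matrix (Fin n) (Fin n) ℝ) (idx : Fin s → Fin n),
      slotAct A (slotAct B X) idx = slotAct (B * A) X idx
        + ∑ a, ∑ b, if b = a then 0 else ∑ e, ∑ f, A e (idx a) * B f (idx b) *
            X (Function.update (Function.update idx a e) b f) := by
    intro A B idx
    simp only [slotAct, ← Finset.sum_add_distrib]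
    refine Finset.sum_congr rfl fun a _ => ?_
    simp only [Finset.mul_sum]
    rw [Finset.sum_comm, ← Finset.add_sum_erase _ _ (Finset.mem_univ a)]
    congr 1
    · simp only [Function.update_self, Function.update_idem, Matrix.mul_apply, Finset.sum_mul]
      rw [Finset.sum_comm]
      exact Finset.sum_congr rfl fun f _ => Finset.sum_congr rfl fun e _ => by ring
    · rw [← Finset.add_sum_erase (a := a) (s := Finset.univ)
        (f := fun b => if b = a then (0 : ℝ) else _) (Finset.mem_univ a), if_pos rfl, zero_add]
      refine Finset.sum_congr rfl fun b hb => ?_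
      have hba : b ≠ a := Finset.ne_of_mem_erase hb
      rw [if_neg hba]
      refine Finset.sum_congr rfl fun e _ => Finset.sum_congr rfl fun f _ => ?_
      rw [Function.update_of_ne hba]; ring
  ext idx
  rw [Pi.sub_apply, expand A B, expand B A, slotAct_sub_left, Pi.sub_apply]
  suffices h : (∑ a, ∑ b, if b = a then 0 else ∑ e, ∑ f, A e (idx a) * B f (idx b) *
        X (Function.update (Function.update idx a e) b f))
      = ∑ a, ∑ b, if b = a then 0 else ∑ e, ∑ f, B e (idx a) * A f (idx b) *
        X (Function.update (Function.update idx a e) b f) by rw [h]; ring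
  rw [Finset.sum_comm]
  refine Finset.sum_congr rfl fun b _ => Finset.sum_congr rfl fun a _ => ?_
  by_cases h : b = a
  · simp [h]
  · rw [if_neg h, if_neg (Ne.symm h), Finset.sum_comm]
    refine Finset.sum_congr rfl fun f _ => Finset.sum_congr rfl fun e _ => ?_
    rw [Function.update_comm h]; ring

theorem slotAct_comp_perm (A : Matrix (Fin n) (Fin n) ℝ) (X : (Fin s → Fin n) → ℝ)
    (σ : Equiv.Perm (Fin s)) (idx : Fin s → Fin n) :
    slotAct A (fun i => X (i ∘ σ)) idx = slotAct A X (idx ∘ σ) := by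
  unfold slotAct
  rw [← Equiv.sum_comp σ]
  refine Finset.sum_congr rfl fun a _ => Finset.sum_congr rfl fun e _ => ?_
  have h := Function.update_comp_equiv idx σ (σ a) e
  rw [Equiv.symm_apply_apply] at h
  simp only [h, Function.comp_apply]

theorem slotAct_cons (A : Matrix (Fin n) (Fin n) ℝ) (X : (Fin (s + 1) → Fin n) → ℝ)
    (j : Fin n) (idx : Fin s → Fin n) :
    slotAct A X (Fin.cons j idx : Fin (s + 1) → Fin n)
      = ∑ e, A e j * X (Fin.cons e idx : Fin (s + 1) → Fin n)
        + slotAct A (fun i => X (Fin.cons j i : Fin (s + 1) → Fin n)) idx := by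
  unfold slotAct
  rw [Fin.sum_univ_succ]
  simp only [Fin.cons_zero, Fin.cons_succ, Fin.update_cons_zero, Fin.cons_update]

theorem slotAct_four (A : Matrix (Fin n) (Fin n) ℝ) (X : (Fin 4 → Fin n) → ℝ)
    (a b c d : Fin n) :
    slotAct A X ![a, b, c, d] = ∑ e, A e a * X ![e, b, c, d] + ∑ e, A e b * X ![a, e, c, d]
      + ∑ e, A e c * X ![a, b, e, d] + ∑ e, A e d * X ![a, b, c, e] := by
  have h0 : ∀ e, Function.update ![a, b, c, d] 0 e = ![e, b, c, d] := fun e => by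
    ext k; fin_cases k <;> rfl
  have h1 : ∀ e, Function.update ![a, b, c, d] 1 e = ![a, e, c, d] := fun e => by
    ext k; fin_cases k <;> rfl
  have h2 : ∀ e, Function.update ![a, b, c, d] 2 e = ![a, b, e, d] := fun e => by
    ext k; fin_cases k <;> rfl
  have h3 : ∀ e, Function.update ![a, b, c, d] 3 e = ![a, b, c, e] := fun e => by
    ext k; fin_cases k <;> rfl
  simp only [slotAct, Fin.sum_univ_four, h0, h1, h2, h3]
  rfl

end SlotAction

/-- A smooth, symmetric, nondegenerate coordinate metric on an open set. -/
structure RegularMetric {n : ℕ} (g : MetricMat n) (U : Set (Fin n → ℝ)) : Prop where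
  isOpen : IsOpen U
  smooth : MatSmoothOn U g
  symm : ∀ x ∈ U, (g x).IsSymm
  nondeg : ∀ x ∈ U, IsUnit (g x).det

/-- The connection matrices `(Γᵢ)^k_j = Γ^k_{ij}`. -/
def connMat {n : ℕ} (g : MetricMat n) (i : Fin n) : MetricMat n :=
  fun x => Matrix.of fun k j => christoffel g x k i j

/-- The curvature matrices `(F_{ij})^l_k = R^l_{kij}`. -/
def curvMat {n : ℕ} (g : MetricMat n) (i j : Fin n) : MetricMat n :=
  fun x => matPd i (connMat g j) x - matPd j (connMat g i) x
    + connMat g i x * connMat g j x - connMat g j x * connMat g i x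

/-- Covariant derivative of an endomorphism field. -/
def endDeriv {n : ℕ} (g : MetricMat n) (e : Fin n) (A : MetricMat n) : MetricMat n :=
  fun x => matPd e A x + connMat g e x * A x - A x * connMat g e x

/-- Covariant derivative of a covariant tensor field in a fixed coordinate direction. -/
def dirDeriv {n s : ℕ} (g : MetricMat n) (e : Fin n) (X : TensorField n s) : TensorField n s :=
  fun x idx => pd e (fun y => X y idx) x - slotAct (connMat g e x) (X x) idx

/-- Componentwise smoothness of a tensor field. -/
def TensorSmoothOn {n s : ℕ} (U : Set (Fin n → ℝ)) (X : TensorField n s) : Prop :=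
  ∀ idx, SmoothOn U fun x => X x idx

section Connection

variable {n s : ℕ} {g : MetricMat n} {U : Set (Fin n → ℝ)} {x : Fin n → ℝ}

theorem RegularMetric.pd_symm (hg : RegularMetric g U) (hx : x ∈ U) (i a b : Fin n) :
    pd i (fun y => g y a b) x = pd i (fun y => g y b a) x :=
  pd_congr hg.isOpen (fun y hy => (hg.symm y hy).apply b a) hx i

theorem RegularMetric.smooth_connMat (hg : RegularMetric g U) (i : Fin n) :
    MatSmoothOn U (connMat g i) := fun k j => by
  have hd : ∀ i a b, SmoothOn U (pd i fun y => g y a b) := fun i a b =>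
    (hg.smooth a b).pd hg.isOpen i
  exact contDiffOn_const.mul (ContDiffOn.sum fun l _ =>
    (hg.smooth.inv hg.nondeg k l).mul (((hd _ _ _).add (hd _ _ _)).sub (hd _ _ _)))

theorem RegularMetric.smooth_curvMat (hg : RegularMetric g U) (i j : Fin n) :
    MatSmoothOn U (curvMat g i j) := by
  have h := hg.smooth_connMat
  exact ((((h j).matPd hg.isOpen i).sub ((h i).matPd hg.isOpen j)).add
    ((h i).mul (h j))).sub ((h j).mul (h i))

theorem riemann_eq_mul_curvMat (idx : Fin 4 → Fin n) :
    riemann g x idx = (g x * curvMat g (idx 2) (idx 3) x) (idx 0) (idx 1) := rfl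

theorem curvMat_swap (i j : Fin n) : curvMat g j i x = -curvMat g i j x := by
  unfold curvMat; abel

theorem RegularMetric.connMat_symm (hg : RegularMetric g U) (hx : x ∈ U) (i j k : Fin n) :
    connMat g i x k j = connMat g j x k i := by
  simp only [connMat, christoffel, Matrix.of_apply]
  congr 1
  refine Finset.sum_congr rfl fun l _ => ?_
  rw [hg.pd_symm hx l i j]; ring

theorem RegularMetric.mul_inv (hg : RegularMetric g U) (hx : x ∈ U) : g x * (g x)⁻¹ = 1 :=
  Matrix.mul_nonsing_inv _ (hg.nondeg x hx)

theorem RegularMetric.mul_connMat (hg : RegularMetric g U) (hx : x ∈ U) (i l k : Fin n) :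
    (g x * connMat g i x) l k = (1 / 2) *
      (pd i (fun y => g y l k) x + pd k (fun y => g y l i) x - pd l (fun y => g y i k) x) := by
  set c : Fin n → ℝ := fun l =>
    pd i (fun y => g y l k) x + pd k (fun y => g y l i) x - pd l (fun y => g y i k) x
  have h : (fun m => connMat g i x m k) = (1 / 2 : ℝ) • ((g x)⁻¹ *ᵥ c) := by
    ext m; rfl
  change (g x *ᵥ fun m => connMat g i x m k) l = (1 / 2) * c l
  rw [h, Matrix.mulVec_smul, Matrix.mulVec_mulVec, hg.mul_inv hx, Matrix.one_mulVec]
  rfl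

theorem RegularMetric.matPd_metric (hg : RegularMetric g U) (hx : x ∈ U) (i : Fin n) :
    matPd i g x = g x * connMat g i x + (connMat g i x)ᵀ * g x := by
  have : (connMat g i x)ᵀ * g x = (g x * connMat g i x)ᵀ := by
    rw [Matrix.transpose_mul, (hg.symm x hx).eq]
  ext l k
  rw [this, Matrix.add_apply, Matrix.transpose_apply, hg.mul_connMat hx, hg.mul_connMat hx,
    matPd_apply, hg.pd_symm hx i k l, hg.pd_symm hx l i k, hg.pd_symm hx k i l]
  ring

theorem RegularMetric.mul_curvMat_antisymm (hg : RegularMetric g U) (hx : x ∈ U) (i j : Fin n) :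
    g x * curvMat g i j x + (g x * curvMat g i j x)ᵀ = 0 := by
  have second : ∀ i j : Fin n, matPd i (matPd j g) x
      = (g x * connMat g i x + (connMat g i x)ᵀ * g x) * connMat g j x
        + g x * matPd i (connMat g j) x
        + ((matPd i (connMat g j) x)ᵀ * g x
        + (connMat g j x)ᵀ * (g x * connMat g i x + (connMat g i x)ᵀ * g x)) := by
    intro i j
    have hs := hg.smooth_connMat j
    rw [matPd_congr hg.isOpen (fun y hy => hg.matPd_metric hy j) hx i,
      matPd_add hg.isOpen (hg.smooth.mul hs) (hs.transpose.mul hg.smooth) hx,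
      matPd_mul hg.isOpen hg.smooth hs hx, matPd_mul hg.isOpen hs.transpose hg.smooth hx,
      matPd_transpose, hg.matPd_metric hx]
  have h := matPd_comm hg.isOpen hg.smooth hx i j
  rw [second i j, second j i, ← sub_eq_zero] at h
  rw [← h, Matrix.transpose_mul, (hg.symm x hx).eq]
  simp only [curvMat, Matrix.transpose_add, Matrix.transpose_sub, Matrix.transpose_mul]
  noncomm_ring

theorem RegularMetric.curvMat_bianchi_first (hg : RegularMetric g U) (hx : x ∈ U)
    (l k i j : Fin n) :
    curvMat g i j x l k + curvMat g j k x l i + curvMat g k i x l j = 0 := by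
  have hs := fun i j => hg.connMat_symm hx i j
  have hp : ∀ e i j l, pd e (fun y => connMat g i y l j) x = pd e (fun y => connMat g j y l i) x :=
    fun e i j l => pd_congr hg.isOpen (fun y hy => hg.connMat_symm hy i j l) hx e
  simp only [curvMat, Matrix.sub_apply, Matrix.add_apply, matPd_apply, Matrix.mul_apply]
  rw [hp i j k, hp j k i, hp k i j, Finset.sum_congr rfl fun m _ => by rw [hs j k m],
    Finset.sum_congr (f := fun m => connMat g j x l m * connMat g k x m i) rfl
      fun m _ => by rw [hs k i m],
    Finset.sum_congr (f := fun m => connMat g k x l m * connMat g i x m j) rfl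
      fun m _ => by rw [hs i j m]]
  ring

theorem RegularMetric.endDeriv_curvMat_cyclic (hg : RegularMetric g U) (hx : x ∈ U)
    (e i j : Fin n) :
    endDeriv g e (curvMat g i j) x + endDeriv g i (curvMat g j e) x
      + endDeriv g j (curvMat g e i) x = 0 := by
  have hc := hg.smooth_connMat
  have expand : ∀ e i j, matPd e (curvMat g i j) x
      = matPd e (matPd i (connMat g j)) x - matPd e (matPd j (connMat g i)) x
        + (matPd e (connMat g i) x * connMat g j x + connMat g i x * matPd e (connMat g j) x)
        - (matPd e (connMat g j) x * connMat g i x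
          + connMat g j x * matPd e (connMat g i) x) := by
    intro e i j
    have h1 := (hc j).matPd hg.isOpen i
    have h2 := (hc i).matPd hg.isOpen j
    have h3 := (hc i).mul (hc j)
    have h4 := (hc j).mul (hc i)
    unfold curvMat
    rw [matPd_sub hg.isOpen ((h1.sub h2).add h3) h4 hx, matPd_add hg.isOpen (h1.sub h2) h3 hx,
      matPd_sub hg.isOpen h1 h2 hx, matPd_mul hg.isOpen (hc i) (hc j) hx,
      matPd_mul hg.isOpen (hc j) (hc i) hx]
  simp only [endDeriv, expand]
  rw [matPd_comm hg.isOpen (hc j) hx e i, matPd_comm hg.isOpen (hc i) hx e j,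
    matPd_comm hg.isOpen (hc e) hx i j]
  simp only [curvMat]
  noncomm_ring

/-- Lowering an index commutes with covariant differentiation. -/
theorem RegularMetric.mul_endDeriv (hg : RegularMetric g U) (hx : x ∈ U) {A : MetricMat n}
    (hA : MatSmoothOn U A) (e : Fin n) :
    g x * endDeriv g e A x = matPd e (fun y => g y * A y) x
      - (connMat g e x)ᵀ * (g x * A x) - g x * A x * connMat g e x := by
  rw [matPd_mul hg.isOpen hg.smooth hA hx, hg.matPd_metric hx, endDeriv]
  noncomm_ring

end Connection

section TensorDerivatives

variable {n s : ℕ} {g : MetricMat n} {U : Set (Fin n → ℝ)} {x : Fin n → ℝ}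

theorem covDeriv_eq_dirDeriv (X : TensorField n s) (x : Fin n → ℝ) (idx : Fin (s + 1) → Fin n) :
    covDeriv g X x idx = dirDeriv g (idx 0) X x (Fin.tail idx) := rfl

theorem covDeriv_cons (X : TensorField n s) (x : Fin n → ℝ) (e : Fin n) (idx : Fin s → Fin n) :
    covDeriv g X x (Fin.cons e idx : Fin (s + 1) → Fin n) = dirDeriv g e X x idx := rfl

theorem TensorSmoothOn.slotAct {A : MetricMat n} {X : TensorField n s} (hA : MatSmoothOn U A)
    (hX : TensorSmoothOn U X) : TensorSmoothOn U fun y => slotAct (A y) (X y) := fun _ =>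
  ContDiffOn.sum fun _ _ => ContDiffOn.sum fun _ _ => (hA _ _).mul (hX _)

theorem TensorSmoothOn.dirDeriv {X : TensorField n s} (hX : TensorSmoothOn U X)
    (hg : RegularMetric g U) (e : Fin n) : TensorSmoothOn U (dirDeriv g e X) := fun idx =>
  ContDiffOn.sub ((hX idx).pd hg.isOpen e) (TensorSmoothOn.slotAct (hg.smooth_connMat e) hX idx)

theorem TensorSmoothOn.covDeriv {X : TensorField n s} (hX : TensorSmoothOn U X)
    (hg : RegularMetric g U) : TensorSmoothOn U (covDeriv g X) := fun _ =>
  hX.dirDeriv hg _ _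

theorem RegularMetric.smooth_riemann (hg : RegularMetric g U) : TensorSmoothOn U (riemann g) :=
  fun idx => hg.smooth.mul (hg.smooth_curvMat (idx 2) (idx 3)) (idx 0) (idx 1)

theorem dirDeriv_eq_zero {X : TensorField n s} (hU : IsOpen U) (h : ∀ y ∈ U, X y = 0)
    (hx : x ∈ U) (e : Fin n) : dirDeriv g e X x = 0 := by
  ext idx
  unfold dirDeriv
  rw [pd_eq_zero_of_eqOn hU (fun y hy => congrFun (h y hy) idx) hx e, h x hx, slotAct_zero_right]
  simp

theorem dirDeriv_add {X Y : TensorField n s} (hU : IsOpen U) (hX : TensorSmoothOn U X)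
    (hY : TensorSmoothOn U Y) (hx : x ∈ U) (e : Fin n) :
    dirDeriv g e (fun y => X y + Y y) x = dirDeriv g e X x + dirDeriv g e Y x := by
  ext idx
  simp only [dirDeriv, Pi.add_apply, slotAct_add_right]
  rw [pd_add ((hX idx).differentiableAt hU hx) ((hY idx).differentiableAt hU hx)]
  ring

theorem dirDeriv_comp_perm (X : TensorField n s) (σ : Equiv.Perm (Fin s)) (e : Fin n)
    (idx : Fin s → Fin n) :
    dirDeriv g e (fun y i => X y (i ∘ σ)) x idx = dirDeriv g e X x (idx ∘ σ) := by
  unfold dirDeriv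
  rw [← slotAct_comp_perm]

theorem pd_slotAct {A : MetricMat n} {X : TensorField n s} (hU : IsOpen U)
    (hA : MatSmoothOn U A) (hX : TensorSmoothOn U X) (hx : x ∈ U) (e : Fin n)
    (idx : Fin s → Fin n) :
    pd e (fun y => slotAct (A y) (X y) idx) x
      = slotAct (matPd e A x) (X x) idx + slotAct (A x) (fun i => pd e (fun y => X y i) x) idx := by
  have h : ∀ a c, DifferentiableAt ℝ
      (fun y => A y c (idx a) * X y (Function.update idx a c)) x := fun a c =>
    DifferentiableAt.fun_mul ((hA _ _).differentiableAt hU hx) ((hX _).differentiableAt hU hx)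
  unfold slotAct
  rw [pd_sum _ fun a _ => DifferentiableAt.fun_sum fun c _ => h a c, ← Finset.sum_add_distrib]
  refine Finset.sum_congr rfl fun a _ => ?_
  rw [pd_sum _ fun c _ => h a c, ← Finset.sum_add_distrib]
  exact Finset.sum_congr rfl fun c _ =>
    pd_mul ((hA _ _).differentiableAt hU hx) ((hX _).differentiableAt hU hx) e

/-- Leibniz rule for the slot action. -/
theorem dirDeriv_slotAct {A : MetricMat n} {X : TensorField n s} (hU : IsOpen U)
    (hA : MatSmoothOn U A) (hX : TensorSmoothOn U X) (hx : x ∈ U) (e : Fin n) :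
    dirDeriv g e (fun y => slotAct (A y) (X y)) x
      = slotAct (endDeriv g e A x) (X x) + slotAct (A x) (dirDeriv g e X x) := by
  have hd : dirDeriv g e X x
      = (fun i => pd e (fun y => X y i) x) - slotAct (connMat g e x) (X x) := rfl
  have hc := slotAct_commutator (A x) (connMat g e x) (X x)
  rw [hd, slotAct_sub_right, endDeriv, add_sub_assoc, slotAct_add_left, ← hc]
  ext idx
  simp only [dirDeriv, Pi.add_apply, Pi.sub_apply]
  rw [pd_slotAct hU hA hX hx]
  ring

/-- The Ricci identity. -/
theorem dirDeriv_commutator {X : TensorField n s} (hg : RegularMetric g U)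
    (hX : TensorSmoothOn U X) (hx : x ∈ U) (i j : Fin n) :
    dirDeriv g i (dirDeriv g j X) x - dirDeriv g j (dirDeriv g i X) x
      = -slotAct (curvMat g i j x) (X x) := by
  have hc := hg.smooth_connMat
  have expand : ∀ i j, dirDeriv g i (dirDeriv g j X) x
      = (fun idx => pd i (pd j fun y => X y idx) x) - slotAct (matPd i (connMat g j) x) (X x)
        - slotAct (connMat g j x) (fun k => pd i (fun y => X y k) x)
        - slotAct (connMat g i x) (fun k => pd j (fun y => X y k) x)
        + slotAct (connMat g i x) (slotAct (connMat g j x) (X x)) := by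
    intro i j
    have hd : dirDeriv g j X x
        = (fun k => pd j (fun y => X y k) x) - slotAct (connMat g j x) (X x) := rfl
    ext idx
    change pd i (fun y => pd j (fun z => X z idx) y - slotAct (connMat g j y) (X y) idx) x
      - slotAct (connMat g i x) (dirDeriv g j X x) idx = _
    rw [pd_sub (((hX idx).pd hg.isOpen j).differentiableAt hg.isOpen hx)
      ((TensorSmoothOn.slotAct (hc j) hX idx).differentiableAt hg.isOpen hx),
      pd_slotAct hg.isOpen (hc j) hX hx, hd, slotAct_sub_right]
    simp only [Pi.add_apply, Pi.sub_apply]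
    ring
  have hcomm : (fun idx => pd i (pd j fun y => X y idx) x)
      = fun idx => pd j (pd i fun y => X y idx) x :=
    funext fun idx => pd_comm (hX idx) hg.isOpen hx i j
  have hb := slotAct_commutator (connMat g i x) (connMat g j x) (X x)
  rw [slotAct_sub_left] at hb
  rw [expand, expand, hcomm, curvMat]
  simp only [slotAct_sub_left, slotAct_add_left]
  linear_combination hb

theorem dirDeriv_dirDeriv_of_parallel {X : TensorField n s}
    (h : ∀ idx, covDeriv g (covDeriv g X) x idx = 0) (i j : Fin n) :
    dirDeriv g i (dirDeriv g j X) x = ∑ e, connMat g i x e j • dirDeriv g e X x := by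
  ext idx
  have h1 := h (Fin.cons i (Fin.cons j idx : Fin (s + 1) → Fin n) : Fin (s + 2) → Fin n)
  rw [covDeriv_cons] at h1
  unfold dirDeriv at h1
  rw [slotAct_cons] at h1
  simp only [covDeriv_cons] at h1
  simp only [Finset.sum_apply, Pi.smul_apply, smul_eq_mul]
  have h2 : dirDeriv g i (dirDeriv g j X) x idx = pd i (fun y => dirDeriv g j X y idx) x
    - slotAct (connMat g i x) (fun k => dirDeriv g j X x k) idx := rfl
  rw [h2]
  change pd i (fun y => dirDeriv g j X y idx) x - (_ + _) = 0 at h1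
  linarith

end TensorDerivatives

section SecondSymmetric

variable {n : ℕ} {g : MetricMat n} {U : Set (Fin n → ℝ)} {x : Fin n → ℝ}

/-- The correction terms of the covariant derivative of a two-form of endomorphisms. -/
def formCorrection (g : MetricMat n) (e : Fin n) (A : Fin n → Fin n → MetricMat n)
    (i j : Fin n) : MetricMat n :=
  fun y => ∑ m, connMat g e y m i • A m j y + ∑ m, connMat g e y m j • A i m y

/-- The covariant derivative `∇ₑ F_{ij}` of the curvature as a matrix field. -/
def curvDeriv (g : MetricMat n) (e i j : Fin n) : MetricMat n :=
  fun y => endDeriv g e (curvMat g i j) y - formCorrection g e (curvMat g) i j y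

theorem MatSmoothOn.endDeriv {A : MetricMat n} (hA : MatSmoothOn U A) (hg : RegularMetric g U)
    (e : Fin n) : MatSmoothOn U (endDeriv g e A) :=
  ((hA.matPd hg.isOpen e).add ((hg.smooth_connMat e).mul hA)).sub (hA.mul (hg.smooth_connMat e))

theorem RegularMetric.smooth_curvDeriv (hg : RegularMetric g U) (e i j : Fin n) :
    MatSmoothOn U (curvDeriv g e i j) := by
  refine ((hg.smooth_curvMat i j).endDeriv hg e).sub fun a b => ?_
  simp only [formCorrection, Matrix.add_apply, Matrix.sum_apply, Matrix.smul_apply, smul_eq_mul]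
  exact (ContDiffOn.sum fun m _ => (hg.smooth_connMat e m i).mul (hg.smooth_curvMat m j a b)).add
    (ContDiffOn.sum fun m _ => (hg.smooth_connMat e m j).mul (hg.smooth_curvMat i m a b))

theorem dirDeriv_of_eq_mul (hg : RegularMetric g U) (hx : x ∈ U) {X : TensorField n 4}
    {A : Fin n → Fin n → MetricMat n} (hA : ∀ i j, MatSmoothOn U (A i j))
    (hX : ∀ y ∈ U, ∀ l k i j, X y ![l, k, i, j] = (g y * A i j y) l k) (e l k i j : Fin n) :
    dirDeriv g e X x ![l, k, i, j]
      = (g x * (endDeriv g e (A i j) x - formCorrection g e A i j x)) l k := by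
  rw [Matrix.mul_sub, hg.mul_endDeriv hx (hA i j)]
  unfold dirDeriv
  rw [pd_congr hg.isOpen (fun y hy => hX y hy l k i j) hx e, slotAct_four]
  simp only [hX x hx, formCorrection, Matrix.sub_apply, matPd_apply, Matrix.mul_add,
    Matrix.mul_sum, Matrix.mul_smul, Matrix.add_apply, Matrix.sum_apply, Matrix.smul_apply,
    smul_eq_mul]
  rw [Matrix.mul_apply (M := (connMat g e x)ᵀ), Matrix.mul_apply (M := g x * A i j x)]
  simp only [Matrix.transpose_apply, mul_comm ((g x * A i j x) l _)]
  ring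

theorem dirDeriv_riemann (hg : RegularMetric g U) (hx : x ∈ U) (e l k i j : Fin n) :
    dirDeriv g e (riemann g) x ![l, k, i, j] = (g x * curvDeriv g e i j x) l k :=
  dirDeriv_of_eq_mul hg hx hg.smooth_curvMat
    (fun _ _ l k i j => riemann_eq_mul_curvMat ![l, k, i, j]) e l k i j

theorem RegularMetric.mul_left_cancel (hg : RegularMetric g U) (hx : x ∈ U)
    {A B : Matrix (Fin n) (Fin n) ℝ} (h : g x * A = g x * B) : A = B := by
  have := congrArg ((g x)⁻¹ * ·) h
  simpa [← Matrix.mul_assoc, Matrix.nonsing_inv_mul _ (hg.nondeg x hx)] using this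

/-- Second-order symmetry: `∇∇R` vanishes on `U`. -/
def SecondSymmetricOn (g : MetricMat n) (U : Set (Fin n → ℝ)) : Prop :=
  ∀ x ∈ U, ∀ idx, covDeriv g (covDeriv g (riemann g)) x idx = 0

theorem slotAct_curvMat_eq_zero {s : ℕ} {X : TensorField n s} (hg : RegularMetric g U)
    (hX : TensorSmoothOn U X) (h : ∀ x ∈ U, ∀ idx, covDeriv g (covDeriv g X) x idx = 0)
    (hx : x ∈ U) (i j : Fin n) : slotAct (curvMat g i j x) (X x) = 0 := by
  have hc := dirDeriv_commutator hg hX hx i j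
  rw [dirDeriv_dirDeriv_of_parallel (h x hx), dirDeriv_dirDeriv_of_parallel (h x hx),
    Finset.sum_congr rfl fun e _ => by rw [hg.connMat_symm hx i j e], sub_self] at hc
  exact neg_eq_zero.1 hc.symm

theorem covDeriv_covDeriv_covDeriv (hg : RegularMetric g U) (h : SecondSymmetricOn g U)
    (hx : x ∈ U) (idx : Fin 7 → Fin n) :
    covDeriv g (covDeriv g (covDeriv g (riemann g))) x idx = 0 :=
  congrFun (dirDeriv_eq_zero hg.isOpen (fun y hy => funext (h y hy)) hx (idx 0)) _

theorem slotAct_curvMat_riemann (hg : RegularMetric g U) (h : SecondSymmetricOn g U)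
    (hx : x ∈ U) (i j : Fin n) : slotAct (curvMat g i j x) (riemann g x) = 0 :=
  slotAct_curvMat_eq_zero hg hg.smooth_riemann h hx i j

theorem slotAct_curvMat_covDeriv (hg : RegularMetric g U) (h : SecondSymmetricOn g U)
    (hx : x ∈ U) (i j : Fin n) :
    slotAct (curvMat g i j x) (covDeriv g (riemann g) x) = 0 :=
  slotAct_curvMat_eq_zero hg (hg.smooth_riemann.covDeriv hg)
    (fun _ hy => covDeriv_covDeriv_covDeriv hg h hy) hx i j

theorem endDeriv_curvMat (e i j : Fin n) :
    endDeriv g e (curvMat g i j) x = curvDeriv g e i j x + formCorrection g e (curvMat g) i j x := by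
  simp [curvDeriv]

theorem endDeriv_curvDeriv (hg : RegularMetric g U) (h : SecondSymmetricOn g U)
    (hx : x ∈ U) (f e i j : Fin n) :
    endDeriv g f (curvDeriv g e i j) x = ∑ m, connMat g f x m e • curvDeriv g m i j x
      + formCorrection g f (curvDeriv g e) i j x := by
  rw [← sub_eq_iff_eq_add]
  apply hg.mul_left_cancel hx
  ext l k
  rw [← dirDeriv_of_eq_mul hg hx (fun i j => hg.smooth_curvDeriv e i j)
    (fun y hy l k i j => dirDeriv_riemann hg hy e l k i j),
    dirDeriv_dirDeriv_of_parallel (h x hx)]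
  simp [Matrix.mul_sum, Matrix.sum_apply, dirDeriv_riemann hg hx]

theorem slotAct_formCorrection {s : ℕ} (A : Fin n → Fin n → MetricMat n) (e i j : Fin n)
    (X : (Fin s → Fin n) → ℝ) :
    slotAct (formCorrection g e A i j x) X
      = ∑ m, connMat g e x m i • slotAct (A m j x) X
        + ∑ m, connMat g e x m j • slotAct (A i m x) X := by
  simp only [formCorrection, slotAct_add_left, slotAct_sum_left, slotAct_smul_left]

theorem slotAct_curvDeriv_covDeriv (hg : RegularMetric g U) (h : SecondSymmetricOn g U)
    (hx : x ∈ U) (e i j : Fin n) :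
    slotAct (curvDeriv g e i j x) (covDeriv g (riemann g) x) = 0 := by
  have h0 := dirDeriv_eq_zero (g := g) hg.isOpen
    (fun y hy => slotAct_curvMat_covDeriv hg h hy i j) hx e
  have hT : dirDeriv g e (covDeriv g (riemann g)) x = 0 :=
    funext fun idx => h x hx (Fin.cons e idx : Fin 6 → Fin n)
  rw [dirDeriv_slotAct hg.isOpen (hg.smooth_curvMat i j) (hg.smooth_riemann.covDeriv hg) hx,
    hT, slotAct_zero_right, add_zero, endDeriv_curvMat, slotAct_add_left,
    slotAct_formCorrection] at h0
  simpa [slotAct_curvMat_covDeriv hg h hx] using h0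

theorem slotAct_curvDeriv_riemann (hg : RegularMetric g U) (h : SecondSymmetricOn g U)
    (hx : x ∈ U) (e i j : Fin n) :
    slotAct (curvDeriv g e i j x) (riemann g x)
      + slotAct (curvMat g i j x) (dirDeriv g e (riemann g) x) = 0 := by
  have h0 := dirDeriv_eq_zero (g := g) hg.isOpen
    (fun y hy => slotAct_curvMat_riemann hg h hy i j) hx e
  rw [dirDeriv_slotAct hg.isOpen (hg.smooth_curvMat i j) hg.smooth_riemann hx,
    endDeriv_curvMat, slotAct_add_left, slotAct_formCorrection] at h0
  simpa [slotAct_curvMat_riemann hg h hx] using h0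

theorem slotAct_curvDeriv_dirDeriv (hg : RegularMetric g U) (h : SecondSymmetricOn g U)
    (hx : x ∈ U) (e f i j : Fin n) :
    slotAct (curvDeriv g e i j x) (dirDeriv g f (riemann g) x)
      + slotAct (curvDeriv g f i j x) (dirDeriv g e (riemann g) x) = 0 := by
  have hR := hg.smooth_riemann
  have hF := hg.smooth_curvMat i j
  have hG := hg.smooth_curvDeriv e i j
  have h1 : ∀ e i j, slotAct (curvDeriv g e i j x) (riemann g x)
      = -slotAct (curvMat g i j x) (dirDeriv g e (riemann g) x) := fun e i j =>
    eq_neg_of_add_eq_zero_left (slotAct_curvDeriv_riemann hg h hx e i j)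
  have h0 := dirDeriv_eq_zero (g := g) hg.isOpen
    (fun y hy => slotAct_curvDeriv_riemann hg h hy e i j) hx f
  rw [dirDeriv_add hg.isOpen (TensorSmoothOn.slotAct hG hR)
      (TensorSmoothOn.slotAct hF (hR.dirDeriv hg e)) hx,
    dirDeriv_slotAct hg.isOpen hG hR hx, dirDeriv_slotAct hg.isOpen hF (hR.dirDeriv hg e) hx,
    endDeriv_curvDeriv hg h hx, endDeriv_curvMat, dirDeriv_dirDeriv_of_parallel (h x hx)] at h0
  simp only [slotAct_add_left, slotAct_formCorrection, slotAct_sum_left, slotAct_sum_right,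
    slotAct_smul_left, slotAct_smul_right, h1, smul_neg, Finset.sum_neg_distrib] at h0
  rw [← h0]
  abel

end SecondSymmetric

section CurvatureSymmetries

variable {n : ℕ} {g : MetricMat n} {U : Set (Fin n → ℝ)} {x : Fin n → ℝ}

theorem dirDeriv_riemann_antisymm_left (hg : RegularMetric g U) (hx : x ∈ U)
    (e a b c d : Fin n) :
    dirDeriv g e (riemann g) x ![b, a, c, d] = -dirDeriv g e (riemann g) x ![a, b, c, d] := by
  have hR := hg.smooth_riemann
  have h0 : ∀ y ∈ U, riemann g y + (fun i => riemann g y (i ∘ Equiv.swap (0 : Fin 4) 1)) = 0 := by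
    intro y hy
    ext idx
    exact congrFun (congrFun (hg.mul_curvMat_antisymm hy (idx 2) (idx 3)) (idx 0)) (idx 1)
  have h1 := dirDeriv_eq_zero (g := g) hg.isOpen h0 hx e
  rw [dirDeriv_add hg.isOpen hR (fun idx => hR _) hx] at h1
  have h2 := congrFun h1 ![a, b, c, d]
  rw [Pi.add_apply, dirDeriv_comp_perm] at h2
  have h3 : ![a, b, c, d] ∘ Equiv.swap (0 : Fin 4) 1 = ![b, a, c, d] := by
    ext k; fin_cases k <;> rfl
  rw [h3] at h2
  exact (neg_eq_of_add_eq_zero_right h2).symm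

theorem dirDeriv_riemann_antisymm_right (hg : RegularMetric g U) (hx : x ∈ U)
    (e a b c d : Fin n) :
    dirDeriv g e (riemann g) x ![a, b, d, c] = -dirDeriv g e (riemann g) x ![a, b, c, d] := by
  have hR := hg.smooth_riemann
  have h0 : ∀ y ∈ U, riemann g y + (fun i => riemann g y (i ∘ Equiv.swap (2 : Fin 4) 3)) = 0 := by
    intro y hy
    ext idx
    change (g y * curvMat g (idx 2) (idx 3) y) (idx 0) (idx 1)
      + (g y * curvMat g (idx 3) (idx 2) y) (idx 0) (idx 1) = 0
    rw [curvMat_swap (idx 2) (idx 3)]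
    simp
  have h1 := dirDeriv_eq_zero (g := g) hg.isOpen h0 hx e
  rw [dirDeriv_add hg.isOpen hR (fun idx => hR _) hx] at h1
  have h2 := congrFun h1 ![a, b, c, d]
  rw [Pi.add_apply, dirDeriv_comp_perm] at h2
  have h3 : ![a, b, c, d] ∘ Equiv.swap (2 : Fin 4) 3 = ![a, b, d, c] := by
    ext k; fin_cases k <;> rfl
  rw [h3] at h2
  exact (neg_eq_of_add_eq_zero_right h2).symm

theorem dirDeriv_riemann_bianchi_first (hg : RegularMetric g U) (hx : x ∈ U)
    (e a b c d : Fin n) :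
    dirDeriv g e (riemann g) x ![a, b, c, d] + dirDeriv g e (riemann g) x ![a, c, d, b]
      + dirDeriv g e (riemann g) x ![a, d, b, c] = 0 := by
  have hR := hg.smooth_riemann
  let σ : Equiv.Perm (Fin 4) := Equiv.swap 1 2 * Equiv.swap 2 3
  have h0 : ∀ y ∈ U, (riemann g y + fun i => riemann g y (i ∘ σ))
      + (fun i => riemann g y (i ∘ (σ * σ : Equiv.Perm (Fin 4)))) = 0 := by
    intro y hy
    ext idx
    change (g y * curvMat g (idx 2) (idx 3) y) (idx 0) (idx 1)
      + (g y * curvMat g (idx 3) (idx 1) y) (idx 0) (idx 2)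
      + (g y * curvMat g (idx 1) (idx 2) y) (idx 0) (idx 3) = 0
    simp only [Matrix.mul_apply, ← Finset.sum_add_distrib, ← mul_add]
    refine Finset.sum_eq_zero fun m _ => ?_
    rw [hg.curvMat_bianchi_first hy, mul_zero]
  have h1 := dirDeriv_eq_zero (g := g) hg.isOpen h0 hx e
  rw [dirDeriv_add (X := fun y => riemann g y + fun i => riemann g y (i ∘ σ)) hg.isOpen
      (fun idx => (hR idx).add (hR _)) (fun idx => hR _) hx,
    dirDeriv_add hg.isOpen hR (fun idx => hR _) hx] at h1
  have h2 := congrFun h1 ![a, b, c, d]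
  rw [Pi.add_apply, Pi.add_apply, dirDeriv_comp_perm, dirDeriv_comp_perm] at h2
  have h3 : ![a, b, c, d] ∘ σ = ![a, c, d, b] := by
    ext k; fin_cases k <;> rfl
  have h4 : ![a, b, c, d] ∘ (σ * σ : Equiv.Perm (Fin 4)) = ![a, d, b, c] := by
    ext k; fin_cases k <;> rfl
  rw [h3, h4] at h2
  exact h2

theorem dirDeriv_riemann_bianchi_second (hg : RegularMetric g U) (hx : x ∈ U)
    (e a b c d : Fin n) :
    dirDeriv g e (riemann g) x ![a, b, c, d] + dirDeriv g c (riemann g) x ![a, b, d, e]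
      + dirDeriv g d (riemann g) x ![a, b, e, c] = 0 := by
  rw [dirDeriv_riemann hg hx, dirDeriv_riemann hg hx, dirDeriv_riemann hg hx,
    ← Matrix.add_apply, ← Matrix.add_apply, ← Matrix.mul_add, ← Matrix.mul_add]
  suffices h : curvDeriv g e c d x + curvDeriv g c d e x + curvDeriv g d e c x = 0 by simp [h]
  have h1 := hg.endDeriv_curvMat_cyclic hx e c d
  rw [endDeriv_curvMat, endDeriv_curvMat, endDeriv_curvMat] at h1
  have swapSum : ∀ i j k : Fin n, ∑ m, connMat g i x m j • curvMat g m k x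
      = -∑ m, connMat g j x m i • curvMat g k m x := by
    intro i j k
    rw [← Finset.sum_neg_distrib]
    refine Finset.sum_congr rfl fun m _ => ?_
    rw [hg.connMat_symm hx i j m, curvMat_swap k m, smul_neg]
  unfold formCorrection at h1
  rw [swapSum e c d, swapSum c d e, swapSum d e c] at h1
  rw [← h1]
  abel

end CurvatureSymmetries

section Pullback

variable {n s : ℕ}

theorem sum_update_swap (a : Fin s) (F : (Fin s → Fin n) → Fin n → ℝ) :
    ∑ idx, ∑ e, F idx e = ∑ idx, ∑ e, F (Function.update idx a e) (idx a) := by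
  have hinv : Function.Involutive
      fun p : (Fin s → Fin n) × Fin n => (Function.update p.1 a p.2, p.1 a) := fun p => by simp
  rw [← Fintype.sum_prod_type', ← Fintype.sum_prod_type']
  exact (Equiv.sum_comp hinv.toPerm fun p : (Fin s → Fin n) × Fin n => F p.1 p.2).symm

/-- The components of a covariant tensor in the frame given by the columns of `P`. -/
def pullTensor (P : Matrix (Fin n) (Fin n) ℝ) (X : (Fin s → Fin n) → ℝ) (idx : Fin s → Fin n) :
    ℝ :=
  ∑ μ, X μ * ∏ t, P (μ t) (idx t)

theorem slotAct_pullTensor {A B P : Matrix (Fin n) (Fin n) ℝ} (h : P * B = A * P)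
    (X : (Fin s → Fin n) → ℝ) :
    slotAct B (pullTensor P X) = pullTensor P (slotAct A X) := by
  have hp : ∀ (u v : Fin s → Fin n) (a : Fin s),
      ∏ t, P (u t) (v t) = P (u a) (v a) * ∏ t ∈ Finset.univ.erase a, P (u t) (v t) :=
    fun u v a => (Finset.mul_prod_erase _ _ (Finset.mem_univ a)).symm
  have hl : ∀ (u v : Fin s → Fin n) (a : Fin s) (e : Fin n),
      ∏ t, P (u t) (Function.update v a e t)
        = P (u a) e * ∏ t ∈ Finset.univ.erase a, P (u t) (v t) := fun u v a e => by
    rw [hp _ _ a, Function.update_self]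
    congr 1
    exact Finset.prod_congr rfl fun t ht => by rw [Function.update_of_ne (Finset.ne_of_mem_erase ht)]
  have hr : ∀ (u v : Fin s → Fin n) (a : Fin s) (e : Fin n),
      ∏ t, P (Function.update u a e t) (v t)
        = P e (v a) * ∏ t ∈ Finset.univ.erase a, P (u t) (v t) := fun u v a e => by
    rw [hp _ _ a, Function.update_self]
    congr 1
    exact Finset.prod_congr rfl fun t ht => by rw [Function.update_of_ne (Finset.ne_of_mem_erase ht)]
  ext idx
  simp only [pullTensor, slotAct, Finset.sum_mul]
  rw [Finset.sum_comm (s := Finset.univ (α := Fin s → Fin n))]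
  refine Finset.sum_congr rfl fun a _ => ?_
  rw [sum_update_swap a]
  simp only [Finset.mul_sum, Function.update_self, Function.update_idem, Function.update_eq_self,
    hl, hr]
  rw [Finset.sum_comm]
  refine Finset.sum_congr rfl fun μ _ => ?_
  have h1 := congrFun (congrFun h (μ a)) (idx a)
  simp only [Matrix.mul_apply] at h1
  calc _ = (∑ e, P (μ a) e * B e (idx a))
        * (X μ * ∏ t ∈ Finset.univ.erase a, P (μ t) (idx t)) := by
        rw [Finset.sum_mul]; exact Finset.sum_congr rfl fun e _ => by ring
    _ = _ := by
        rw [h1, Finset.sum_mul]; exact Finset.sum_congr rfl fun e _ => by ring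

theorem pullTensor_comp_perm (P : Matrix (Fin n) (Fin n) ℝ) (X : (Fin s → Fin n) → ℝ)
    (σ : Equiv.Perm (Fin s)) (idx : Fin s → Fin n) :
    pullTensor P (fun i => X (i ∘ σ)) idx = pullTensor P X (idx ∘ σ) := by
  refine Fintype.sum_equiv (σ.symm.arrowCongr (Equiv.refl (Fin n))) _ _ fun μ => ?_
  congr 1
  exact (Equiv.prod_comp σ fun t => P (μ t) (idx t)).symm

theorem pullTensor_cons (P : Matrix (Fin n) (Fin n) ℝ) (X : (Fin (s + 1) → Fin n) → ℝ)
    (e : Fin n) (idx : Fin s → Fin n) :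
    pullTensor P X (Fin.cons e idx : Fin (s + 1) → Fin n)
      = ∑ m, P m e * pullTensor P (fun i => X (Fin.cons m i : Fin (s + 1) → Fin n)) idx := by
  unfold pullTensor
  rw [← Equiv.sum_comp (Fin.consEquiv fun _ => Fin n), Fintype.sum_prod_type]
  refine Finset.sum_congr rfl fun m _ => ?_
  rw [Finset.mul_sum]
  refine Finset.sum_congr rfl fun μ _ => ?_
  simp [Fin.prod_univ_succ, Fin.consEquiv]
  ring

theorem pullTensor_add (P : Matrix (Fin n) (Fin n) ℝ) (X Y : (Fin s → Fin n) → ℝ) :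
    pullTensor P (X + Y) = pullTensor P X + pullTensor P Y := by
  ext idx; simp [pullTensor, add_mul, Finset.sum_add_distrib]

theorem pullTensor_zero (P : Matrix (Fin n) (Fin n) ℝ) :
    pullTensor P (0 : (Fin s → Fin n) → ℝ) = 0 := by
  ext idx; simp [pullTensor]

theorem pullTensor_smul (P : Matrix (Fin n) (Fin n) ℝ) (c : ℝ) (X : (Fin s → Fin n) → ℝ) :
    pullTensor P (c • X) = c • pullTensor P X := by
  ext idx; simp [pullTensor, mul_assoc, Finset.mul_sum]

theorem pullTensor_sum {ι : Type*} (t : Finset ι) (P : Matrix (Fin n) (Fin n) ℝ)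
    (X : ι → (Fin s → Fin n) → ℝ) :
    pullTensor P (∑ k ∈ t, X k) = ∑ k ∈ t, pullTensor P (X k) := by
  ext idx
  simp only [pullTensor, Finset.sum_apply, Finset.sum_mul]
  exact Finset.sum_comm

theorem pullTensor_eq_zero {P : Matrix (Fin n) (Fin n) ℝ} {X : (Fin s → Fin n) → ℝ}
    {idx : Fin s → Fin n} (k : Fin s) (p : Fin n) (hP : ∀ m, m ≠ p → P m (idx k) = 0)
    (hX : ∀ μ, μ k = p → X μ = 0) : pullTensor P X idx = 0 := by
  refine Finset.sum_eq_zero fun μ _ => ?_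
  by_cases h : μ k = p
  · rw [hX μ h, zero_mul]
  · rw [Finset.prod_eq_zero (Finset.mem_univ k) (hP _ h), mul_zero]

/-- Contraction with a skew matrix in one slot is a skew operator on covariant tensors. -/
theorem sum_slotAct_mul {A : Matrix (Fin n) (Fin n) ℝ} (hA : ∀ i j, A j i = -A i j)
    (X Y : (Fin s → Fin n) → ℝ) :
    ∑ idx, slotAct A X idx * Y idx = -∑ idx, slotAct A Y idx * X idx := by
  simp only [slotAct, Finset.sum_mul]
  rw [Finset.sum_comm (s := Finset.univ (α := Fin s → Fin n)),
    Finset.sum_comm (s := Finset.univ (α := Fin s → Fin n)), ← Finset.sum_neg_distrib]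
  refine Finset.sum_congr rfl fun a _ => ?_
  rw [sum_update_swap a, ← Finset.sum_neg_distrib]
  refine Finset.sum_congr rfl fun μ _ => ?_
  rw [← Finset.sum_neg_distrib]
  refine Finset.sum_congr rfl fun e _ => ?_
  simp only [Function.update_self, Function.update_idem, Function.update_eq_self, hA e]
  ring

theorem sum_fin_four (F : (Fin 4 → Fin n) → ℝ) :
    ∑ idx, F idx = ∑ a, ∑ b, ∑ c, ∑ d, F ![a, b, c, d] := by
  let φ : (Fin 4 → Fin n) ≃ Fin n × Fin n × Fin n × Fin n :=
    ⟨fun f => (f 0, f 1, f 2, f 3), fun p => ![p.1, p.2.1, p.2.2.1, p.2.2.2],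
      fun f => by ext k; fin_cases k <;> rfl, fun _ => rfl⟩
  rw [← Equiv.sum_comp φ.symm]
  simp only [Fintype.sum_prod_type]
  rfl

end Pullback

section SpatialVanishing

variable {d : ℕ}

/-- A family of tensors with the symmetries of `∇R` on a Euclidean space which is annihilated
by the operators it defines vanishes. -/
theorem eq_zero_of_slotAct_self (u : Fin d → (Fin 4 → Fin d) → ℝ)
    (hanti : ∀ e a b i j, u e ![b, a, i, j] = -u e ![a, b, i, j])
    (hbianchi : ∀ e a b i j, u e ![a, b, i, j] + u a ![b, e, i, j] + u b ![e, a, i, j] = 0)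
    (hact : ∀ e f i j, slotAct (Matrix.of fun s m => u e ![s, m, i, j]) (u f)
      + slotAct (Matrix.of fun s m => u f ![s, m, i, j]) (u e) = 0)
    (hact' : ∀ e m i j, ∑ s, u e ![s, m, i, j] • u s
      + slotAct (Matrix.of fun s m => u e ![s, m, i, j]) (u m) = 0) : u = 0 := by
  set h : Fin d → Fin d → ℝ := fun e f => ∑ idx, u e idx * u f idx with hh
  have hK : ∀ e f m i j,
      ∑ s, u e ![s, m, i, j] * h s f + ∑ s, u f ![s, m, i, j] * h s e = 0 := by
    intro e f m i j
    set A : Fin d → Matrix (Fin d) (Fin d) ℝ := fun e => Matrix.of fun s m => u e ![s, m, i, j]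
    have hA : ∀ e f m, ∑ s, u e ![s, m, i, j] * h s f
        = -∑ idx, slotAct (A e) (u m) idx * u f idx := by
      intro e f m
      have h1 := congrArg (fun X : (Fin 4 → Fin d) → ℝ => ∑ idx, X idx * u f idx)
        (hact' e m i j)
      simp only [Pi.add_apply, add_mul, Finset.sum_add_distrib, Finset.sum_apply, Pi.smul_apply,
        smul_eq_mul, Pi.zero_apply, zero_mul, Finset.sum_const_zero] at h1
      rw [← eq_neg_of_add_eq_zero_left h1]
      simp only [hh, Finset.mul_sum, Finset.sum_mul, mul_assoc]
      exact Finset.sum_comm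
    have h1 := congrArg (fun X : (Fin 4 → Fin d) → ℝ => ∑ idx, X idx * u m idx) (hact e f i j)
    simp only [Pi.add_apply, add_mul, Finset.sum_add_distrib, Pi.zero_apply, zero_mul,
      Finset.sum_const_zero] at h1
    have hskew : ∀ e s m, A e m s = -A e s m := fun e s m => hanti e s m i j
    rw [hA, hA, sum_slotAct_mul (hskew e), sum_slotAct_mul (hskew f), neg_neg, neg_neg]
    exact h1
  have hS1 : ∀ e, 0 ≤ ∑ idx : Fin 4 → Fin d,
      u e idx * ∑ s, u e ![s, idx 1, idx 2, idx 3] * h s (idx 0) := by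
    intro e
    rw [sum_fin_four, Finset.sum_comm]
    refine Finset.sum_nonneg fun m _ => ?_
    rw [Finset.sum_comm]
    refine Finset.sum_nonneg fun i _ => ?_
    rw [Finset.sum_comm]
    refine Finset.sum_nonneg fun j _ => ?_
    have : ∑ f, u e ![f, m, i, j] * ∑ s, u e ![s, m, i, j] * h s f
        = ∑ idx, (∑ s, u e ![s, m, i, j] * u s idx) ^ 2 := by
      simp only [hh, sq, Finset.mul_sum, Finset.sum_mul]
      rw [Finset.sum_comm (s := Finset.univ (α := Fin 4 → Fin d))]
      refine Finset.sum_congr rfl fun f _ => ?_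
      rw [Finset.sum_comm]
      exact Finset.sum_congr rfl fun s _ => Finset.sum_congr rfl fun idx _ => by ring
    exact this.symm ▸ Finset.sum_nonneg fun idx _ => sq_nonneg _
  have hS2 : ∀ e, ∑ idx : Fin 4 → Fin d,
      u e idx * ∑ s, u (idx 0) ![s, idx 1, idx 2, idx 3] * h s e
        = ∑ s, 1 / 2 * h s e ^ 2 := by
    intro e
    simp only [Finset.mul_sum]
    rw [Finset.sum_comm]
    refine Finset.sum_congr rfl fun s _ => ?_
    have h1 : ∑ idx : Fin 4 → Fin d, u e idx * u (idx 0) ![s, idx 1, idx 2, idx 3]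
        = 1 / 2 * h s e := by
      simp only [hh]
      rw [sum_fin_four, sum_fin_four]
      have h2 : ∑ f, ∑ m, ∑ i, ∑ j, u e ![f, m, i, j] * u f ![s, m, i, j]
          = ∑ f, ∑ m, ∑ i, ∑ j, u e ![m, f, i, j] * u m ![s, f, i, j] := Finset.sum_comm
      have h3 : ∑ f, ∑ m, ∑ i, ∑ j, u s ![f, m, i, j] * u e ![f, m, i, j]
          = ∑ f, ∑ m, ∑ i, ∑ j, u e ![f, m, i, j] * u f ![s, m, i, j]
            + ∑ f, ∑ m, ∑ i, ∑ j, u e ![m, f, i, j] * u m ![s, f, i, j] := by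
        simp only [← Finset.sum_add_distrib]
        refine Finset.sum_congr rfl fun f _ => Finset.sum_congr rfl fun m _ =>
          Finset.sum_congr rfl fun i _ => Finset.sum_congr rfl fun j _ => ?_
        have hb := hbianchi s f m i j
        have ha := hanti f s m i j
        have hc := hanti e f m i j
        rw [hc]
        linear_combination u e ![f, m, i, j] * hb - u e ![f, m, i, j] * ha
      rw [h3, ← h2]
      change ∑ f, ∑ m, ∑ i, ∑ j, u e ![f, m, i, j] * u f ![s, m, i, j] = _
      ring
    calc _ = (∑ idx : Fin 4 → Fin d, u e idx * u (idx 0) ![s, idx 1, idx 2, idx 3]) * h s e := by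
          rw [Finset.sum_mul]; exact Finset.sum_congr rfl fun idx _ => by ring
      _ = _ := by rw [h1]; ring
  have hsum : ∀ e, ∑ s, 1 / 2 * h s e ^ 2 ≤ 0 := by
    intro e
    rw [← hS2 e]
    have h1 : ∑ idx : Fin 4 → Fin d, u e idx * ∑ s, u e ![s, idx 1, idx 2, idx 3] * h s (idx 0)
        + ∑ idx : Fin 4 → Fin d, u e idx * ∑ s, u (idx 0) ![s, idx 1, idx 2, idx 3] * h s e
        = 0 := by
      rw [← Finset.sum_add_distrib]
      refine Finset.sum_eq_zero fun idx _ => ?_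
      rw [← mul_add, hK, mul_zero]
    linarith [hS1 e]
  ext e idx
  have h1 : 1 / 2 * h e e ^ 2 = 0 :=
    (Finset.sum_eq_zero_iff_of_nonneg fun s _ => by positivity).1
      (le_antisymm (hsum e) (Finset.sum_nonneg fun s _ => by positivity)) e (Finset.mem_univ e)
  have h2 : h e e = 0 := by simpa using h1
  exact mul_self_eq_zero.1
    ((Finset.sum_eq_zero_iff_of_nonneg fun idx _ => mul_self_nonneg (u e idx)).1 h2 idx
      (Finset.mem_univ idx))

end SpatialVanishing

section NullComponents

variable {d : ℕ}

theorem Matrix.eq_zero_of_mul_transpose_self {B : Matrix (Fin d) (Fin d) ℝ} (h : B * Bᵀ = 0) :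
    B = 0 := by
  rwa [← Matrix.conjTranspose_eq_transpose_of_trivial, Matrix.self_mul_conjTranspose_eq_zero] at h

theorem Matrix.eq_zero_of_normal_of_two_sq {B : Matrix (Fin d) (Fin d) ℝ}
    (hn : Bᵀ * B = B * Bᵀ) (h : (2 : ℝ) • (B * B) = B * Bᵀ) : B = 0 := by
  have ht : (2 : ℝ) • (Bᵀ * Bᵀ) = B * Bᵀ := by simpa using congrArg Matrix.transpose h
  have h1 : (B * B) * (B * B)ᵀ = (4 : ℝ) • ((B * B) * (B * B)ᵀ) :=
    calc (B * B) * (B * B)ᵀ = B * (B * Bᵀ) * Bᵀ := by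
          rw [Matrix.transpose_mul]; simp only [Matrix.mul_assoc]
      _ = B * (Bᵀ * B) * Bᵀ := by rw [hn]
      _ = (B * Bᵀ) * (B * Bᵀ) := by simp only [Matrix.mul_assoc]
      _ = ((2 : ℝ) • (B * B)) * ((2 : ℝ) • (Bᵀ * Bᵀ)) := by rw [h, ht]
      _ = _ := by
          rw [Matrix.smul_mul, Matrix.mul_smul, smul_smul, Matrix.transpose_mul]; norm_num
  have h2 : (3 : ℝ) • ((B * B) * (B * B)ᵀ) = 0 := by
    have : (3 : ℝ) = 4 - 1 := by norm_num
    rw [this, sub_smul, ← h1, one_smul, sub_self]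
  have h3 : B * B = 0 :=
    Matrix.eq_zero_of_mul_transpose_self ((smul_eq_zero.1 h2).resolve_left (by norm_num))
  rw [h3, smul_zero] at h
  exact Matrix.eq_zero_of_mul_transpose_self h.symm

/-- A tensor `Y p k m`, symmetric in its last two slots, vanishes if it is annihilated by its own
contractions in the stated sense. -/
theorem eq_zero_of_contraction_eq_zero (Y : Fin d → Fin d → Fin d → ℝ)
    (hsymm : ∀ p k m, Y p k m = Y p m k)
    (h : ∀ p a k m, ∑ s, Y p s a * (3 * Y s k m - Y k s m - Y m s k) = 0) (p k m : Fin d) :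
    Y p k m = 0 := by
  let F : (Fin d → ℝ) → (Fin d → ℝ) → (Fin d → ℝ) → ℝ := fun u v w =>
    ∑ s, ∑ r, ∑ q, u s * v r * w q * Y s r q
  let L : (Fin d → ℝ) → (Fin d → ℝ) → Fin d → ℝ := fun u v q => ∑ s, ∑ r, u s * v r * Y s r q
  have hFL : ∀ u v w, F u v w = ∑ q, L u v q * w q := by
    intro u v w
    simp only [F, L, Finset.sum_mul]
    symm
    rw [Finset.sum_comm]
    refine Finset.sum_congr rfl fun s _ => ?_
    rw [Finset.sum_comm]
    exact Finset.sum_congr rfl fun r _ => Finset.sum_congr rfl fun q _ => by ring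
  have hF : ∀ u v w, F u v w = F u w v := by
    intro u v w
    simp only [F]
    refine Finset.sum_congr rfl fun s _ => ?_
    rw [Finset.sum_comm]
    exact Finset.sum_congr rfl fun r _ => Finset.sum_congr rfl fun q _ => by rw [hsymm]; ring
  have hK : ∀ a b v u, 3 * F (L a b) v u = F v (L a b) u + F u (L a b) v := by
    intro a b v u
    have hD : ∀ k m, ∑ s, L a b s * (3 * Y s k m - Y k s m - Y m s k) = 0 := by
      intro k m
      simp only [L, Finset.sum_mul]
      rw [Finset.sum_comm]
      refine Finset.sum_eq_zero fun p _ => ?_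
      rw [Finset.sum_comm]
      refine Finset.sum_eq_zero fun r _ => ?_
      simp only [mul_assoc, ← Finset.mul_sum]
      rw [Finset.sum_congr rfl fun s _ => by rw [hsymm p r s], h, mul_zero, mul_zero]
    generalize L a b = w at hD
    have e1 : F w v u = ∑ k, ∑ m, ∑ s, v k * u m * (w s * Y s k m) := by
      simp only [F]
      rw [Finset.sum_comm]
      refine Finset.sum_congr rfl fun k _ => ?_
      rw [Finset.sum_comm]
      exact Finset.sum_congr rfl fun m _ => Finset.sum_congr rfl fun s _ => by ring
    have e2 : F v w u = ∑ k, ∑ m, ∑ s, v k * u m * (w s * Y k s m) := by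
      simp only [F]
      refine Finset.sum_congr rfl fun k _ => ?_
      rw [Finset.sum_comm]
      exact Finset.sum_congr rfl fun m _ => Finset.sum_congr rfl fun s _ => by ring
    have e3 : F u w v = ∑ k, ∑ m, ∑ s, v k * u m * (w s * Y m s k) := by
      simp only [F]
      rw [Finset.sum_congr rfl fun s _ => Finset.sum_comm, Finset.sum_comm]
      exact Finset.sum_congr rfl fun k _ => Finset.sum_congr rfl fun m _ =>
        Finset.sum_congr rfl fun s _ => by ring
    rw [e1, e2, e3, ← sub_eq_zero]
    simp only [Finset.mul_sum, ← Finset.sum_add_distrib, ← Finset.sum_sub_distrib]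
    refine Finset.sum_eq_zero fun k _ => Finset.sum_eq_zero fun m _ => ?_
    rw [← mul_zero (v k * u m), ← hD k m, Finset.mul_sum]
    exact Finset.sum_congr rfl fun s _ => by ring
  have hsq : ∀ u v, F u v (L u v) = 0 → L u v = 0 := by
    intro u v h0
    rw [hFL] at h0
    ext q
    exact mul_self_eq_zero.1 ((Finset.sum_eq_zero_iff_of_nonneg fun q _ =>
      mul_self_nonneg (L u v q)).1 h0 q (Finset.mem_univ q))
  have hzero : ∀ u v w, L u v = 0 → F u v w = 0 := fun u v w h0 => by simp [hFL, h0]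
  have h1 : ∀ a b a' b', L (L a b) (L a' b') = 0 := by
    intro a b a' b'
    apply hsq
    generalize hw : L (L a b) (L a' b') = w
    have e1 := hK a b (L a' b') w
    have e2 := hK a' b' (L a b) w
    have e3 : 3 * F w (L a b) (L a' b') = F (L a b) w (L a' b') + F (L a' b') w (L a b) :=
      hw ▸ hK (L a b) (L a' b') (L a b) (L a' b')
    rw [hF (L a b) w, hF (L a' b') w] at e3
    rw [hF w (L a' b')] at e2
    linarith
  have h2 : ∀ u a b, L u (L a b) = 0 := by
    intro u a b
    apply hsq
    have e1 := hK a b u (L u (L a b))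
    rw [hF, hzero _ _ u (h1 a b u (L a b)), hzero _ _ u (h1 u (L a b) a b)] at e1
    linarith
  have h3 : ∀ u v, L u v = 0 := by
    intro u v
    apply hsq
    rw [hF]
    exact hzero _ _ _ (h2 _ _ _)
  have h4 := congrFun (h3 (Pi.single p 1) (Pi.single k 1)) m
  simpa [L, Pi.single_apply] using h4

/-- The algebraic identities satisfied by the components of `∇R` in an adapted null frame, `sp`
being the embedding of the spatial indices; the contractions run over spatial indices only. -/
structure ReducedCurvatureDerivative {d : ℕ} {ι : Type*} (sp : Fin d → ι)
    (t : ι → ι → ι → ι → ι → ℝ) : Prop where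
  antisymm_left : ∀ e a b i j, t e b a i j = -t e a b i j
  pair_symm : ∀ e a b i j, t e i j a b = t e a b i j
  bianchi : ∀ e a b i j, t e a b i j + t a b e i j + t b e a i j = 0
  act : ∀ e f i j a b k l,
    (∑ s, t e (sp s) a i j * t f (sp s) b k l + ∑ s, t e (sp s) b i j * t f a (sp s) k l
      + ∑ s, t e (sp s) k i j * t f a b (sp s) l + ∑ s, t e (sp s) l i j * t f a b k (sp s))
    + (∑ s, t f (sp s) a i j * t e (sp s) b k l + ∑ s, t f (sp s) b i j * t e a (sp s) k l
      + ∑ s, t f (sp s) k i j * t e a b (sp s) l + ∑ s, t f (sp s) l i j * t e a b k (sp s)) = 0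
  act' : ∀ e m i j a b k l,
    ∑ s, t e (sp s) m i j * t (sp s) a b k l
    + (∑ s, t e (sp s) a i j * t m (sp s) b k l + ∑ s, t e (sp s) b i j * t m a (sp s) k l
      + ∑ s, t e (sp s) k i j * t m a b (sp s) l + ∑ s, t e (sp s) l i j * t m a b k (sp s)) = 0

namespace ReducedCurvatureDerivative

variable {ι : Type*} {sp : Fin d → ι} {t : ι → ι → ι → ι → ι → ℝ}

theorem antisymm_right (ht : ReducedCurvatureDerivative sp t) (e a b i j : ι) :
    t e a b j i = -t e a b i j := by
  rw [← ht.pair_symm, ht.antisymm_left, ht.pair_symm]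

theorem spatial_eq_zero (ht : ReducedCurvatureDerivative sp t) (e a b i j : Fin d) :
    t (sp e) (sp a) (sp b) (sp i) (sp j) = 0 := by
  have h := eq_zero_of_slotAct_self
    (fun e idx => t (sp e) (sp (idx 0)) (sp (idx 1)) (sp (idx 2)) (sp (idx 3)))
    (fun e a b i j => ht.antisymm_left _ _ _ _ _) (fun e a b i j => ht.bianchi _ _ _ _ _)
    (fun e f i j => ?_) (fun e m i j => ?_)
  · exact congrFun (congrFun h e) ![a, b, i, j]
  · ext idx
    have hidx : idx = ![idx 0, idx 1, idx 2, idx 3] := by ext k; fin_cases k <;> rfl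
    rw [hidx, Pi.add_apply, slotAct_four, slotAct_four]
    exact ht.act (sp e) (sp f) (sp i) (sp j) (sp (idx 0)) (sp (idx 1)) (sp (idx 2)) (sp (idx 3))
  · ext idx
    have hidx : idx = ![idx 0, idx 1, idx 2, idx 3] := by ext k; fin_cases k <;> rfl
    rw [hidx, Pi.add_apply, slotAct_four, Finset.sum_apply]
    exact ht.act' (sp e) (sp m) (sp i) (sp j) (sp (idx 0)) (sp (idx 1)) (sp (idx 2)) (sp (idx 3))

theorem null_slot_eq_zero (ht : ReducedCurvatureDerivative sp t) (o : ι) (p k l m : Fin d) :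
    t (sp p) o (sp k) (sp l) (sp m) = 0 := by
  have hS := ht.spatial_eq_zero
  let B : Matrix (Fin d) (Fin d) ℝ := Matrix.of fun p k => t (sp p) o (sp k) (sp l) (sp m)
  have hA : ∀ s k, t o (sp s) (sp k) (sp l) (sp m) = B s k - B k s := by
    intro s k
    have h1 := ht.bianchi o (sp s) (sp k) (sp l) (sp m)
    have h2 := ht.antisymm_left (sp s) o (sp k) (sp l) (sp m)
    simp only [B, Matrix.of_apply]
    linarith
  have hB : ∀ p s, t (sp p) (sp s) o (sp l) (sp m) = -B p s := fun p s =>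
    ht.antisymm_left _ _ _ _ _
  have hB' : ∀ p k, t (sp p) o (sp k) (sp l) (sp m) = B p k := fun p k => rfl
  have h1 : B * ((2 : ℝ) • B - Bᵀ) = 0 := by
    ext p k
    have h := ht.act' (sp p) o (sp l) (sp m) o (sp k) (sp l) (sp m)
    simp only [hS, hA, hB, hB', zero_mul, Finset.sum_const_zero, add_zero] at h
    simp only [Matrix.mul_apply, Matrix.sub_apply, Matrix.smul_apply, Matrix.transpose_apply,
      smul_eq_mul, Matrix.zero_apply]
    rw [← neg_eq_zero, ← h, ← Finset.sum_add_distrib, ← Finset.sum_neg_distrib]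
    exact Finset.sum_congr rfl fun s _ => by ring
  have h2 : Bᵀ * B = B * Bᵀ := by
    ext p k
    have h := ht.act (sp p) o (sp l) (sp m) o (sp k) (sp l) (sp m)
    have h' := ht.act' o (sp p) (sp l) (sp m) o (sp k) (sp l) (sp m)
    simp only [hS, hA, hB, hB', mul_zero, zero_mul, Finset.sum_const_zero, add_zero,
      zero_add] at h h'
    have h3 : ∑ s, B s p * B s k - ∑ s, B p s * B k s
        = ∑ s, (B s p - B p s) * B s k - ∑ s, -B p s * (B s k - B k s) := by
      simp only [← Finset.sum_sub_distrib]
      exact Finset.sum_congr rfl fun s _ => by ring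
    simp only [Matrix.mul_apply, Matrix.transpose_apply]
    linarith
  refine congrFun (congrFun (Matrix.eq_zero_of_normal_of_two_sq h2 ?_) p) k
  rw [Matrix.mul_sub, Matrix.mul_smul] at h1
  exact sub_eq_zero.1 h1

theorem null_derivative_eq_zero (ht : ReducedCurvatureDerivative sp t) (o : ι) (a b i j : Fin d) :
    t o (sp a) (sp b) (sp i) (sp j) = 0 := by
  have h1 := ht.bianchi o (sp a) (sp b) (sp i) (sp j)
  have h2 := ht.antisymm_left (sp a) o (sp b) (sp i) (sp j)
  rw [ht.null_slot_eq_zero] at h1 h2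
  rw [h2] at h1
  linarith

theorem null_derivative_null_slot (ht : ReducedCurvatureDerivative sp t) (o : ι) (k l m : Fin d) :
    t o o (sp k) (sp l) (sp m)
      = t (sp l) o (sp k) o (sp m) - t (sp m) o (sp k) o (sp l) := by
  have h1 := ht.bianchi o (sp l) (sp m) o (sp k)
  have h2 := ht.antisymm_left (sp l) o (sp m) o (sp k)
  rw [ht.pair_symm] at h1
  have h3 := ht.pair_symm (sp l) o (sp k) o (sp m)
  have h4 := ht.pair_symm (sp m) o (sp k) o (sp l)
  linarith

theorem null_null_slot_eq_zero (ht : ReducedCurvatureDerivative sp t) (o : ι) (p k m : Fin d) :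
    t (sp p) o (sp k) o (sp m) = 0 := by
  refine eq_zero_of_contraction_eq_zero (fun p k m => t (sp p) o (sp k) o (sp m))
    (fun p k m => ht.pair_symm _ _ _ _ _) (fun p a k m => ?_) p k m
  have h := ht.act' (sp p) o (sp a) o o (sp k) o (sp m)
  have hZ : ∀ s k a, t (sp p) (sp s) (sp k) (sp a) o = 0 := fun s k a => by
    rw [ht.antisymm_right, ht.pair_symm, ht.null_slot_eq_zero, neg_zero]
  have hY : ∀ s a, t (sp p) (sp s) o (sp a) o = t (sp p) o (sp s) o (sp a) := fun s a => by
    rw [ht.antisymm_right, ht.antisymm_left, neg_neg]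
  have hX : ∀ s, t o (sp s) (sp k) o (sp m)
      = t (sp s) o (sp m) o (sp k) - t (sp k) o (sp m) o (sp s) := fun s => by
    rw [ht.pair_symm, ht.null_derivative_null_slot]
  simp only [hZ, hY, hX, ht.null_derivative_null_slot o k, zero_mul, Finset.sum_const_zero,
    add_zero] at h
  rw [← h, ← Finset.sum_add_distrib, ← Finset.sum_add_distrib]
  refine Finset.sum_congr rfl fun s _ => ?_
  rw [ht.pair_symm (sp s) o (sp k) o (sp m), ht.pair_symm (sp k) o (sp s) o (sp m),
    ht.pair_symm (sp m) o (sp s) o (sp k)]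
  ring

theorem self_pair_eq_zero (ht : ReducedCurvatureDerivative sp t) (e a i j : ι) :
    t e a a i j = 0 := by
  have := ht.antisymm_left e a a i j
  linarith

theorem eq_zero_or (ht : ReducedCurvatureDerivative sp t) {o e a b i j : ι}
    (he : e = o ∨ ∃ s, e = sp s) (ha : a = o ∨ ∃ s, a = sp s) (hb : b = o ∨ ∃ s, b = sp s)
    (hi : i = o ∨ ∃ s, i = sp s) (hj : j = o ∨ ∃ s, j = sp s) :
    t e a b i j = 0 ∨ (e = o ∧ ((a = o ∧ ∃ s, b = sp s) ∨ (b = o ∧ ∃ s, a = sp s))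
      ∧ ((i = o ∧ ∃ s, j = sp s) ∨ (j = o ∧ ∃ s, i = sp s))) := by
  have hS := ht.self_pair_eq_zero
  have hS' : ∀ e a i, t e a i o o = 0 := fun e a i => by rw [← ht.pair_symm, hS]
  have h0 := ht.null_slot_eq_zero o
  have h1 : ∀ p k l m, t (sp p) (sp k) o (sp l) (sp m) = 0 := fun p k l m => by
    rw [ht.antisymm_left, h0, neg_zero]
  have h2 : ∀ k l m, t o o (sp k) (sp l) (sp m) = 0 := fun k l m => by
    rw [ht.null_derivative_null_slot, ht.null_null_slot_eq_zero, ht.null_null_slot_eq_zero,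
      sub_zero]
  have h3 : ∀ k l m, t o (sp k) o (sp l) (sp m) = 0 := fun k l m => by
    rw [ht.antisymm_left, h2, neg_zero]
  have h4 := ht.null_null_slot_eq_zero o
  have h5 : ∀ p k m, t (sp p) (sp k) o o (sp m) = 0 := fun p k m => by
    rw [ht.antisymm_left, h4, neg_zero]
  have h6 : ∀ p k m, t (sp p) o (sp k) (sp m) o = 0 := fun p k m => by
    rw [ht.antisymm_right, h4, neg_zero]
  have h7 : ∀ p k m, t (sp p) (sp k) o (sp m) o = 0 := fun p k m => by
    rw [ht.antisymm_right, h5, neg_zero]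
  have h8 : ∀ p k l m, t (sp p) (sp k) (sp l) o (sp m) = 0 := fun p k l m => by
    rw [ht.pair_symm, h0]
  have h9 : ∀ p k l m, t (sp p) (sp k) (sp l) (sp m) o = 0 := fun p k l m => by
    rw [ht.pair_symm, h1]
  have h10 : ∀ k l m, t o (sp k) (sp l) o (sp m) = 0 := fun k l m => by rw [ht.pair_symm, h2]
  have h11 : ∀ k l m, t o (sp k) (sp l) (sp m) o = 0 := fun k l m => by rw [ht.pair_symm, h3]
  have h12 := ht.null_derivative_eq_zero o
  have h13 := ht.spatial_eq_zero
  obtain he | ⟨e, rfl⟩ := he <;> obtain ha | ⟨a, rfl⟩ := ha <;> obtain hb | ⟨b, rfl⟩ := hb <;>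
    obtain hi | ⟨i, rfl⟩ := hi <;> obtain hj | ⟨j, rfl⟩ := hj <;> simp [*]

end ReducedCurvatureDerivative

end NullComponents

section ParallelVector

variable {n : ℕ} {g : MetricMat n} {U : Set (Fin n → ℝ)} {x : Fin n → ℝ}

theorem dirDeriv_riemann_pair_symm (hg : RegularMetric g U) (hx : x ∈ U) (e a b c d : Fin n) :
    dirDeriv g e (riemann g) x ![c, d, a, b] = dirDeriv g e (riemann g) x ![a, b, c, d] := by
  have hl := dirDeriv_riemann_antisymm_left hg hx e
  have hr := dirDeriv_riemann_antisymm_right hg hx e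
  have hb := dirDeriv_riemann_bianchi_first hg hx e
  linarith [hb a b c d, hb b c d a, hb c d a b, hb d a b c, hl a b c d, hl a c d b, hl a d b c,
    hl b c d a, hl b d a c, hl c d a b, hr a b c d, hr a c b d, hr a d b c, hr b c a d,
    hr b d a c, hr c d a b, hr b a c d, hr c a b d, hr d a b c, hr c b a d, hr d b a c,
    hr d c a b]

theorem dirDeriv_riemann_bianchi_pair (hg : RegularMetric g U) (hx : x ∈ U) (e a b c d : Fin n) :
    dirDeriv g e (riemann g) x ![a, b, c, d] + dirDeriv g a (riemann g) x ![b, e, c, d]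
      + dirDeriv g b (riemann g) x ![e, a, c, d] = 0 := by
  have h := dirDeriv_riemann_bianchi_second hg hx e c d a b
  rwa [dirDeriv_riemann_pair_symm hg hx e, dirDeriv_riemann_pair_symm hg hx a,
    dirDeriv_riemann_pair_symm hg hx b] at h

theorem covDeriv_riemann_eq_dirDeriv (μ : Fin 5 → Fin n) : covDeriv g (riemann g) x μ
    = dirDeriv g (μ 0) (riemann g) x ![μ 1, μ 2, μ 3, μ 4] := by
  rw [covDeriv_eq_dirDeriv]
  congr 1
  ext t; fin_cases t <;> rfl

theorem curvMat_col_eq_zero (hU : IsOpen U) {p : Fin n}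
    (hp : ∀ y ∈ U, ∀ i k, connMat g i y k p = 0) (hx : x ∈ U) (i j l : Fin n) :
    curvMat g i j x l p = 0 := by
  simp only [curvMat, Matrix.add_apply, Matrix.sub_apply, Matrix.mul_apply, matPd_apply,
    hp x hx, mul_zero, Finset.sum_const_zero]
  rw [pd_eq_zero_of_eqOn hU (fun y hy => hp y hy j l) hx,
    pd_eq_zero_of_eqOn hU (fun y hy => hp y hy i l) hx]
  simp

theorem riemann_eq_zero_of_parallel (hU : IsOpen U) {p : Fin n}
    (hp : ∀ y ∈ U, ∀ i k, connMat g i y k p = 0) (hx : x ∈ U) (l i j : Fin n) :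
    riemann g x ![l, p, i, j] = 0 := by
  rw [riemann_eq_mul_curvMat]
  change ∑ m, g x l m * curvMat g i j x m p = 0
  simp [curvMat_col_eq_zero hU hp hx]

theorem dirDeriv_riemann_eq_zero_of_parallel (hU : IsOpen U) {p : Fin n}
    (hp : ∀ y ∈ U, ∀ i k, connMat g i y k p = 0) (hx : x ∈ U) (e l i j : Fin n) :
    dirDeriv g e (riemann g) x ![l, p, i, j] = 0 := by
  have hR := fun y (hy : y ∈ U) => riemann_eq_zero_of_parallel hU hp hy
  rw [dirDeriv, slotAct_four, pd_eq_zero_of_eqOn hU (fun y hy => hR y hy l i j) hx]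
  simp [hR x hx, hp x hx]

/-- If the `p`-th coordinate field is parallel, every component of `∇R` with an index `p`
vanishes. -/
theorem covDeriv_riemann_eq_zero_of_parallel (hg : RegularMetric g U) {p : Fin n}
    (hp : ∀ y ∈ U, ∀ i k, connMat g i y k p = 0) (hx : x ∈ U) {μ : Fin 5 → Fin n} {k : Fin 5}
    (hk : μ k = p) : covDeriv g (riemann g) x μ = 0 := by
  have h1 := dirDeriv_riemann_eq_zero_of_parallel hg.isOpen hp hx
  have h0 : ∀ e b i j, dirDeriv g e (riemann g) x ![p, b, i, j] = 0 := fun e b i j => by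
    rw [dirDeriv_riemann_antisymm_left hg hx, h1, neg_zero]
  rw [covDeriv_riemann_eq_dirDeriv]
  fin_cases k <;> simp only [Fin.zero_eta, Fin.mk_one, Fin.reduceFinMk] at hk <;> rw [hk]
  · have h := dirDeriv_riemann_bianchi_pair hg hx p (μ 1) (μ 2) (μ 3) (μ 4)
    rwa [h1, h0, add_zero, add_zero] at h
  · rw [h0]
  · rw [h1]
  · rw [dirDeriv_riemann_pair_symm hg hx, h0]
  · rw [dirDeriv_riemann_pair_symm hg hx, h1]

end ParallelVector

section NullFrame

theorem Fin.eq_zero_or_one_or_succ_succ {d : ℕ} (a : Fin (d + 2)) :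
    a = 0 ∨ a = 1 ∨ ∃ s : Fin d, a = s.succ.succ := by
  induction a using Fin.cases with
  | zero => exact Or.inl rfl
  | succ a => induction a using Fin.cases with
    | zero => exact Or.inr (Or.inl rfl)
    | succ s => exact Or.inr (Or.inr ⟨s, rfl⟩)

theorem nullFrameGram_mul_self (d : ℕ) : nullFrameGram d * nullFrameGram d = 1 := by
  ext a b
  rw [Matrix.mul_apply, Fin.sum_univ_succ, Fin.sum_univ_succ]
  rcases Fin.eq_zero_or_one_or_succ_succ a with rfl | rfl | ⟨a, rfl⟩ <;>
    rcases Fin.eq_zero_or_one_or_succ_succ b with rfl | rfl | ⟨b, rfl⟩ <;>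
    simp [nullFrameGram, Fin.succ_succ_ne_one, (Fin.succ_succ_ne_one _).symm, Matrix.one_apply,
      (Fin.succ_ne_zero _).symm]

variable {d : ℕ}

theorem sum_nullFrameGram_mul (F : Matrix (Fin (d + 2)) (Fin (d + 2)) ℝ) (Y : Fin (d + 2) → ℝ)
    (a : Fin (d + 2)) (hF : F 0 a = 0) (hY : Y 0 = 0) :
    ∑ q, (nullFrameGram d * F) q a * Y q
      = ∑ s : Fin d, F s.succ.succ a * Y s.succ.succ := by
  have h1 : (nullFrameGram d * F) 1 a = 0 := by
    rw [Matrix.mul_apply, Fin.sum_univ_succ, Fin.sum_univ_succ]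
    simp [nullFrameGram, hF]
  have h2 : ∀ s : Fin d, (nullFrameGram d * F) s.succ.succ a = F s.succ.succ a := fun s => by
    rw [Matrix.mul_apply, Fin.sum_univ_succ, Fin.sum_univ_succ]
    simp [nullFrameGram, Fin.succ_succ_ne_one]
  rw [Fin.sum_univ_succ, Fin.sum_univ_succ]
  simp only [Fin.succ_zero_eq_one, h1, h2, hY]
  simp

end NullFrame

section FrameComponents

variable {n : ℕ}

theorem pullTensor_comp_perm_eq_neg (P : Matrix (Fin n) (Fin n) ℝ) {s : ℕ}
    {X : (Fin s → Fin n) → ℝ} {σ : Equiv.Perm (Fin s)} (h : ∀ μ, X (μ ∘ σ) = -X μ)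
    (idx : Fin s → Fin n) : pullTensor P X (idx ∘ σ) = -pullTensor P X idx := by
  rw [← pullTensor_comp_perm, funext h]
  simp [pullTensor]

theorem pullTensor_five (P : Matrix (Fin n) (Fin n) ℝ) (X : (Fin 5 → Fin n) → ℝ)
    (e i j a b : Fin n) :
    pullTensor P X ![e, i, j, a, b] = ∑ e', P e' e * ∑ i', P i' i * ∑ j', P j' j *
      ∑ a', P a' a * ∑ b', P b' b * X ![e', i', j', a', b'] := by
  have h0 : ∀ (Z : (Fin 0 → Fin n) → ℝ) idx, pullTensor P Z idx = Z ![] := fun Z idx => by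
    simp only [pullTensor, Finset.univ_eq_empty, Finset.prod_empty, mul_one]
    rw [Fintype.sum_unique]
    exact congrArg Z (Subsingleton.elim _ _)
  have h := fun (s : ℕ) => pullTensor_cons (s := s) P
  simp only [Matrix.vecCons, h, h0]

variable {g : MetricMat n} {U : Set (Fin n → ℝ)} {x : Fin n → ℝ}

/-- The frame components of the matrices `curvDeriv`, with form and derivative slots contracted
with the columns of `P`. -/
def frameCurvDeriv (g : MetricMat n) (x : Fin n → ℝ) (P : Matrix (Fin n) (Fin n) ℝ)
    (e i j : Fin n) : Matrix (Fin n) (Fin n) ℝ :=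
  ∑ e', P e' e • ∑ i', P i' i • ∑ j', P j' j • curvDeriv g e' i' j' x

theorem slotAct_frameCurvDeriv {s : ℕ} (P : Matrix (Fin n) (Fin n) ℝ) (e i j : Fin n)
    (X : (Fin s → Fin n) → ℝ) :
    slotAct (frameCurvDeriv g x P e i j) X
      = ∑ e', P e' e • ∑ i', P i' i • ∑ j', P j' j • slotAct (curvDeriv g e' i' j' x) X := by
  simp only [frameCurvDeriv, slotAct_sum_left, slotAct_smul_left]

theorem slotAct_frameCurvDeriv_covDeriv (hg : RegularMetric g U) (h : SecondSymmetricOn g U)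
    (hx : x ∈ U) (P : Matrix (Fin n) (Fin n) ℝ) (e i j : Fin n) :
    slotAct (frameCurvDeriv g x P e i j) (covDeriv g (riemann g) x) = 0 := by
  simp [slotAct_frameCurvDeriv, slotAct_curvDeriv_covDeriv hg h hx]

theorem slotAct_frameCurvDeriv_dirDeriv (hg : RegularMetric g U) (h : SecondSymmetricOn g U)
    (hx : x ∈ U) (P : Matrix (Fin n) (Fin n) ℝ) (e f i j : Fin n) :
    slotAct (frameCurvDeriv g x P e i j) (∑ f', P f' f • dirDeriv g f' (riemann g) x)
      + slotAct (frameCurvDeriv g x P f i j) (∑ f', P f' e • dirDeriv g f' (riemann g) x) = 0 := by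
  let Q : Fin n → Fin n → (Fin 4 → Fin n) → ℝ := fun e' f' => ∑ i', P i' i • ∑ j', P j' j •
    slotAct (curvDeriv g e' i' j' x) (dirDeriv g f' (riemann g) x)
  have hQ : ∀ e' f', Q e' f' + Q f' e' = 0 := fun e' f' => by
    simp only [Q, ← Finset.sum_add_distrib, ← smul_add, slotAct_curvDeriv_dirDeriv hg h hx,
      smul_zero, Finset.sum_const_zero]
  have key : ∀ e f, slotAct (frameCurvDeriv g x P e i j)
      (∑ f', P f' f • dirDeriv g f' (riemann g) x) = ∑ f', ∑ e', (P f' f * P e' e) • Q e' f' := by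
    intro e f
    rw [slotAct_sum_right]
    refine Finset.sum_congr rfl fun f' _ => ?_
    rw [slotAct_smul_right, slotAct_frameCurvDeriv, Finset.smul_sum]
    exact Finset.sum_congr rfl fun e' _ => by rw [smul_smul]
  rw [key, key, Finset.sum_comm (s := Finset.univ) (t := Finset.univ)
    (f := fun f' e' => (P f' e * P e' f) • Q e' f'), ← Finset.sum_add_distrib]
  refine Finset.sum_eq_zero fun f' _ => ?_
  rw [← Finset.sum_add_distrib]
  refine Finset.sum_eq_zero fun e' _ => ?_
  rw [mul_comm (P e' e), ← smul_add, hQ, smul_zero]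

/-- The components of `∇R` in the frame given by the columns of `P`. -/
def frameNablaRiemann (g : MetricMat n) (x : Fin n → ℝ) (P : Matrix (Fin n) (Fin n) ℝ)
    (e a b i j : Fin n) : ℝ :=
  pullTensor P (covDeriv g (riemann g) x) ![e, a, b, i, j]

theorem frameNablaRiemann_antisymm_left (hg : RegularMetric g U) (hx : x ∈ U)
    (P : Matrix (Fin n) (Fin n) ℝ) (e a b i j : Fin n) :
    frameNablaRiemann g x P e b a i j = -frameNablaRiemann g x P e a b i j := by
  have h := pullTensor_comp_perm_eq_neg P (X := covDeriv g (riemann g) x)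
    (σ := Equiv.swap (1 : Fin 5) 2) (fun μ => by
      rw [covDeriv_riemann_eq_dirDeriv, covDeriv_riemann_eq_dirDeriv μ]
      exact dirDeriv_riemann_antisymm_left hg hx _ _ _ _ _) ![e, a, b, i, j]
  unfold frameNablaRiemann
  rw [← h]
  congr 1
  ext t; fin_cases t <;> rfl

theorem frameNablaRiemann_pair_symm (hg : RegularMetric g U) (hx : x ∈ U)
    (P : Matrix (Fin n) (Fin n) ℝ) (e a b i j : Fin n) :
    frameNablaRiemann g x P e i j a b = frameNablaRiemann g x P e a b i j := by
  have h := pullTensor_comp_perm P (covDeriv g (riemann g) x)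
    (Equiv.swap (1 : Fin 5) 3 * Equiv.swap (2 : Fin 5) 4) ![e, a, b, i, j]
  rw [show (fun μ : Fin 5 → Fin n => covDeriv g (riemann g) x
      (μ ∘ ⇑(Equiv.swap (1 : Fin 5) 3 * Equiv.swap (2 : Fin 5) 4)))
      = covDeriv g (riemann g) x from funext fun μ => by
    rw [covDeriv_riemann_eq_dirDeriv, covDeriv_riemann_eq_dirDeriv μ]
    exact dirDeriv_riemann_pair_symm hg hx _ _ _ _ _] at h
  unfold frameNablaRiemann
  rw [h]
  congr 1
  ext t; fin_cases t <;> rfl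

theorem frameNablaRiemann_bianchi (hg : RegularMetric g U) (hx : x ∈ U)
    (P : Matrix (Fin n) (Fin n) ℝ) (e a b i j : Fin n) :
    frameNablaRiemann g x P e a b i j + frameNablaRiemann g x P a b e i j
      + frameNablaRiemann g x P b e a i j = 0 := by
  let σ : Equiv.Perm (Fin 5) := Equiv.swap 0 1 * Equiv.swap 1 2
  let X := covDeriv g (riemann g) x
  have h0 : X + (fun μ => X (μ ∘ σ)) + (fun μ => X (μ ∘ ⇑(σ * σ))) = 0 := by
    ext μ
    simp only [Pi.add_apply, Pi.zero_apply, X]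
    rw [covDeriv_riemann_eq_dirDeriv, covDeriv_riemann_eq_dirDeriv (μ ∘ σ),
      covDeriv_riemann_eq_dirDeriv (μ ∘ ⇑(σ * σ))]
    exact dirDeriv_riemann_bianchi_pair hg hx _ _ _ _ _
  have h := congrFun (congrArg (pullTensor P) h0) ![e, a, b, i, j]
  rw [pullTensor_add, pullTensor_add, pullTensor_zero, Pi.add_apply, Pi.add_apply,
    pullTensor_comp_perm, pullTensor_comp_perm] at h
  have h1 : ![e, a, b, i, j] ∘ σ = ![a, b, e, i, j] := by ext t; fin_cases t <;> rfl
  have h2 : ![e, a, b, i, j] ∘ ⇑(σ * σ) = ![b, e, a, i, j] := by ext t; fin_cases t <;> rfl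
  rw [h1, h2] at h
  exact h

theorem frameNablaRiemann_eq_mul (hg : RegularMetric g U) (hx : x ∈ U)
    (P : Matrix (Fin n) (Fin n) ℝ) (e i j : Fin n) :
    (Matrix.of fun a b => frameNablaRiemann g x P e a b i j)
      = Pᵀ * g x * frameCurvDeriv g x P e i j * P := by
  ext a b
  rw [Matrix.of_apply, ← frameNablaRiemann_pair_symm hg hx, frameNablaRiemann, pullTensor_five]
  have h1 : ∀ e' i' j' a' b', covDeriv g (riemann g) x ![e', i', j', a', b']
      = (g x * curvDeriv g e' i' j' x) a' b' := fun e' i' j' a' b' => by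
    rw [← dirDeriv_riemann hg hx, ← dirDeriv_riemann_pair_symm hg hx]
    rfl
  have h2 : ∀ A : Matrix (Fin n) (Fin n) ℝ,
      ∑ a', P a' a * ∑ b', P b' b * (g x * A) a' b' = (Pᵀ * g x * A * P) a b := fun A => by
    rw [Matrix.mul_assoc, Matrix.mul_assoc, Matrix.mul_apply, ← Matrix.mul_assoc]
    refine Finset.sum_congr rfl fun a' _ => ?_
    rw [Matrix.transpose_apply, Matrix.mul_apply]
    congr 1
    exact Finset.sum_congr rfl fun b' _ => mul_comm _ _
  simp only [h1, h2, frameCurvDeriv, Matrix.mul_sum, Matrix.sum_mul, Matrix.mul_smul,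
    Matrix.smul_mul, Matrix.sum_apply, Matrix.smul_apply, smul_eq_mul]

end FrameComponents

section NullFrameComponents

variable {d : ℕ} {g : MetricMat (d + 2)} {U : Set (Fin (d + 2) → ℝ)} {x : Fin (d + 2) → ℝ}

/-- The components of `∇R` in a null frame whose vector `e₀` annihilates `∇R` satisfy the reduced
identities. -/
theorem reducedCurvatureDerivative_frameNablaRiemann (hg : RegularMetric g U)
    (h : SecondSymmetricOn g U) (hx : x ∈ U) {P : Matrix (Fin (d + 2)) (Fin (d + 2)) ℝ}
    (hP : Pᵀ * g x * P = nullFrameGram d)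
    (h0 : ∀ (idx : Fin 5 → Fin (d + 2)) (k : Fin 5), idx k = 0 →
      pullTensor P (covDeriv g (riemann g) x) idx = 0) :
    ReducedCurvatureDerivative (fun s : Fin d => s.succ.succ) (frameNablaRiemann g x P) := by
  let F : Fin (d + 2) → Fin (d + 2) → Fin (d + 2) → Matrix (Fin (d + 2)) (Fin (d + 2)) ℝ :=
    fun e i j => Matrix.of fun a b => frameNablaRiemann g x P e a b i j
  let B := fun e i j => nullFrameGram d * F e i j
  have hPP : P * (nullFrameGram d * (Pᵀ * g x)) = 1 := by
    rw [mul_eq_one_comm, Matrix.mul_assoc, hP, nullFrameGram_mul_self]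
  have hB : ∀ e i j, P * B e i j = frameCurvDeriv g x P e i j * P := fun e i j => by
    have := frameNablaRiemann_eq_mul hg hx P e i j
    simp only [B, F, this]
    calc _ = P * (nullFrameGram d * (Pᵀ * g x)) * (frameCurvDeriv g x P e i j * P) := by
          simp only [Matrix.mul_assoc]
      _ = _ := by rw [hPP, Matrix.one_mul]
  have hsum : ∀ e i j a (Y : Fin (d + 2) → ℝ), Y 0 = 0 → ∑ q, B e i j q a * Y q
      = ∑ s : Fin d, frameNablaRiemann g x P e s.succ.succ a i j * Y s.succ.succ :=
    fun e i j a Y hY => sum_nullFrameGram_mul (F e i j) Y a (h0 _ 1 rfl) hY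
  have hfour : ∀ e i j f a b k l,
      slotAct (B e i j) (fun idx => pullTensor P (covDeriv g (riemann g) x)
        (Fin.cons f idx : Fin 5 → Fin (d + 2))) ![a, b, k, l]
      = ∑ s : Fin d, frameNablaRiemann g x P e s.succ.succ a i j
            * frameNablaRiemann g x P f s.succ.succ b k l
        + ∑ s : Fin d, frameNablaRiemann g x P e s.succ.succ b i j
            * frameNablaRiemann g x P f a s.succ.succ k l
        + ∑ s : Fin d, frameNablaRiemann g x P e s.succ.succ k i j
            * frameNablaRiemann g x P f a b s.succ.succ l
        + ∑ s : Fin d, frameNablaRiemann g x P e s.succ.succ l i j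
            * frameNablaRiemann g x P f a b k s.succ.succ := by
    intro e i j f a b k l
    rw [slotAct_four, ← hsum e i j a (fun q => frameNablaRiemann g x P f q b k l) (h0 _ 1 rfl),
      ← hsum e i j b (fun q => frameNablaRiemann g x P f a q k l) (h0 _ 2 rfl),
      ← hsum e i j k (fun q => frameNablaRiemann g x P f a b q l) (h0 _ 3 rfl),
      ← hsum e i j l (fun q => frameNablaRiemann g x P f a b k q) (h0 _ 4 rfl)]
    rfl
  have hcons : ∀ f, (fun idx => pullTensor P (covDeriv g (riemann g) x)
      (Fin.cons f idx : Fin 5 → Fin (d + 2)))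
      = pullTensor P (∑ f', P f' f • dirDeriv g f' (riemann g) x) := fun f => by
    ext idx
    rw [pullTensor_cons, pullTensor_sum, Finset.sum_apply]
    refine Finset.sum_congr rfl fun m _ => ?_
    rw [pullTensor_smul]
    rfl
  refine ⟨frameNablaRiemann_antisymm_left hg hx P, frameNablaRiemann_pair_symm hg hx P,
    frameNablaRiemann_bianchi hg hx P, fun e f i j a b k l => ?_, fun e m i j a b k l => ?_⟩
  · rw [← hfour, ← hfour, hcons, hcons, slotAct_pullTensor (hB e i j),
      slotAct_pullTensor (hB f i j), ← Pi.add_apply, ← pullTensor_add,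
      slotAct_frameCurvDeriv_dirDeriv hg h hx, pullTensor_zero, Pi.zero_apply]
  · rw [← hfour, ← hsum e i j m (fun q => frameNablaRiemann g x P q a b k l) (h0 _ 0 rfl)]
    have h1 := congrFun (slotAct_pullTensor (hB e i j) (covDeriv g (riemann g) x))
      (Fin.cons m ![a, b, k, l] : Fin 5 → Fin (d + 2))
    rw [slotAct_frameCurvDeriv_covDeriv hg h hx, pullTensor_zero, slotAct_cons] at h1
    exact h1

end NullFrameComponents

section Brinkmann

variable {d : ℕ} {U : Set (Fin (d + 2) → ℝ)} {H : (Fin (d + 2) → ℝ) → ℝ}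
  {W : Fin d → (Fin (d + 2) → ℝ) → ℝ} {gs : (Fin (d + 2) → ℝ) → Matrix (Fin d) (Fin d) ℝ}

theorem isUnit_det_of_isLorentzMat {n : ℕ} {A : Matrix (Fin n) (Fin n) ℝ} (hA : IsLorentzMat A) :
    IsUnit A.det := by
  obtain ⟨P, -, hP⟩ := hA
  have h := congrArg Matrix.det hP
  rw [Matrix.det_mul, Matrix.det_mul, Matrix.det_diagonal] at h
  refine isUnit_iff_ne_zero.2 fun h0 => ?_
  rw [h0, mul_zero, zero_mul] at h
  refine Finset.prod_ne_zero_iff.2 (fun i _ => ?_) h.symm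
  split_ifs <;> norm_num

theorem brinkmannMat_isSymm {x : Fin (d + 2) → ℝ} (hgs : (gs x).IsSymm) :
    (brinkmannMat d H W gs x).IsSymm := by
  ext k l
  have h : ∑ i : Fin d, ∑ j : Fin d, (if l = i.succ.succ ∧ k = j.succ.succ then gs x i j else 0)
      = ∑ i : Fin d, ∑ j : Fin d, if k = i.succ.succ ∧ l = j.succ.succ then gs x i j else 0 := by
    rw [Finset.sum_comm]
    exact Finset.sum_congr rfl fun i _ => Finset.sum_congr rfl fun j _ => by
      rw [hgs.apply]; exact if_congr and_comm rfl rfl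
  simp only [Matrix.transpose_apply, brinkmannMat, h]
  have h1 : (if l = 0 ∧ k = 0 then -2 * H x else 0) = if k = 0 ∧ l = 0 then -2 * H x else 0 :=
    if_congr and_comm rfl rfl
  have h2 : (if l = 0 ∧ k = 1 ∨ l = 1 ∧ k = 0 then (-1 : ℝ) else 0)
      = if k = 0 ∧ l = 1 ∨ k = 1 ∧ l = 0 then -1 else 0 := if_congr (by tauto) rfl rfl
  rw [h1, h2]
  ring

theorem brinkmannMat_apply_one (x : Fin (d + 2) → ℝ) (k : Fin (d + 2)) :
    brinkmannMat d H W gs x k 1 = if k = 0 then -1 else 0 := by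
  simp [brinkmannMat, (Fin.succ_succ_ne_one _).symm]

theorem smoothOn_brinkmannMat (hH : ContDiffOn ℝ (⊤ : ℕ∞) H U)
    (hW : ∀ i, ContDiffOn ℝ (⊤ : ℕ∞) (W i) U)
    (hgs : ∀ i j, ContDiffOn ℝ (⊤ : ℕ∞) (fun x => gs x i j) U) :
    MatSmoothOn U (brinkmannMat d H W gs) := fun k l => by
  refine ((((?_ : SmoothOn U _).add ?_).add ?_).add ?_).add ?_
  · split_ifs
    exacts [contDiffOn_const.mul hH, contDiffOn_const]
  · exact contDiffOn_const
  · split_ifs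
    · refine ContDiffOn.sum fun i _ => ?_
      split_ifs
      exacts [(hW i).neg, contDiffOn_const]
    · exact contDiffOn_const
  · split_ifs
    · refine ContDiffOn.sum fun i _ => ?_
      split_ifs
      exacts [(hW i).neg, contDiffOn_const]
    · exact contDiffOn_const
  · refine ContDiffOn.sum fun i _ => ContDiffOn.sum fun j _ => ?_
    split_ifs
    exacts [hgs i j, contDiffOn_const]

theorem vIndep_brinkmannMat (hH : vIndep H) (hW : ∀ i, vIndep (W i)) (hgs : vIndep gs) :
    vIndep (brinkmannMat d H W gs) := fun x t => by
  ext k l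
  simp only [brinkmannMat, hH x t, hgs x t, fun i => hW i x t]

theorem pd_one_eq_zero_of_vIndep {f : (Fin (d + 2) → ℝ) → ℝ} (hf : vIndep f)
    (x : Fin (d + 2) → ℝ) : pd 1 f x = 0 := by
  by_cases hd : DifferentiableAt ℝ f x
  · rw [pd, ← hd.lineDeriv_eq_fderiv, lineDeriv]
    have h : (fun t : ℝ => f (x + t • Pi.single 1 1)) = fun _ => f x := by
      ext t
      rw [← hf x (x 1 + t)]
      congr 1
      ext k
      by_cases hk : k = 1
      · subst hk; simp
      · simp [hk]
    rw [h, deriv_const]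
  · rw [pd, fderiv_zero_of_not_differentiableAt hd]
    rfl

theorem connMat_brinkmannMat_col_one (hH : vIndep H) (hW : ∀ i, vIndep (W i)) (hgs : vIndep gs)
    (x : Fin (d + 2) → ℝ) (i k : Fin (d + 2)) :
    connMat (brinkmannMat d H W gs) i x k 1 = 0 := by
  have h1 : ∀ i l, pd i (fun y => brinkmannMat d H W gs y l 1) x = 0 := fun i l => by
    simp [brinkmannMat_apply_one, pd]
  have h2 : ∀ l, pd 1 (fun y => brinkmannMat d H W gs y l i) x = 0 := fun l =>
    pd_one_eq_zero_of_vIndep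
      (fun y t => congrFun (congrFun (vIndep_brinkmannMat hH hW hgs y t) l) i) x
  simp [connMat, christoffel, h1, h2]

end Brinkmann

/-!
## STATEMENT 3
In a proper second-order symmetric Brinkmann spacetime, written in a Brinkmann chart,
consider an adapted null frame `{e₀, e₁, eᵢ}` where `e₀` is proportional to the parallel
null vector field (which in Brinkmann coordinates is `∂v`, the coordinate field of
`x 1`), `g(e₀,e₁) = -1`, and `{eᵢ}` is an orthonormal spacelike frame orthogonal to
`e₀, e₁`.  Then the only possibly non-vanishing components of `∇R` in this frame are
those of the form `∇₀R¹_{i0j}`; all other components vanish identically.  (Writing the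
fully covariant tensor `∇R` evaluated on frame vectors, a component `∇₀R¹_{i0j}` is,
up to sign, `(∇R)(e₁; e₁, eᵢ, e₁, eⱼ)`, since lowering/raising an index with the null
metric exchanges the labels `0 ↔ 1`; so the claim is that a frame component
`(∇R)(e_{a₀}; e_{a₁},…,e_{a₄})` vanishes unless `a₀ = 1` and the curvature slots have
the pattern `(e₁, eᵢ, e₁, eⱼ)` up to the pair symmetries of the curvature tensor.)
-/
theorem brinkmann_proper_second_symmetric_nablaR_frame_components
    {d : ℕ} (U : Set (Fin (d + 2) → ℝ)) (hU : IsOpen U)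
    (H : (Fin (d + 2) → ℝ) → ℝ) (W : Fin d → (Fin (d + 2) → ℝ) → ℝ)
    (gs : (Fin (d + 2) → ℝ) → Matrix (Fin d) (Fin d) ℝ)
    (hHv : vIndep H) (hWv : ∀ i, vIndep (W i)) (hgsv : vIndep gs)
    (hHs : ContDiffOn ℝ (⊤ : ℕ∞) H U)
    (hWs : ∀ i, ContDiffOn ℝ (⊤ : ℕ∞) (W i) U)
    (hgss : ∀ i j, ContDiffOn ℝ (⊤ : ℕ∞) (fun x => gs x i j) U)
    (hgsym : ∀ x ∈ U, (gs x).IsSymm) (hgpos : ∀ x ∈ U, (gs x).PosDef)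
    (hlor : ∀ x ∈ U, IsLorentzMat (brinkmannMat d H W gs x))
    (h2sym : RthSymmetricOn (brinkmannMat d H W gs) U 2)
    (hproper : ¬ RthSymmetricOn (brinkmannMat d H W gs) U 1)
    (E : Fin (d + 2) → (Fin (d + 2) → ℝ) → Fin (d + 2) → ℝ)
    (hE0 : ∀ x ∈ U, ∃ c : ℝ, c ≠ 0 ∧ E 0 x = c • (Pi.single (1 : Fin (d + 2)) 1 : Fin (d + 2) → ℝ))
    (hframe : ∀ x ∈ U, ∀ a b : Fin (d + 2),
      gApply (brinkmannMat d H W gs) x (E a x) (E b x) = nullFrameGram d a b) :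
    ∀ x ∈ U, ∀ a : Fin 5 → Fin (d + 2),
      ¬ (a 0 = 1
          ∧ ((a 1 = 1 ∧ 2 ≤ ((a 2 : Fin (d + 2)) : ℕ))
              ∨ (a 2 = 1 ∧ 2 ≤ ((a 1 : Fin (d + 2)) : ℕ)))
          ∧ ((a 3 = 1 ∧ 2 ≤ ((a 4 : Fin (d + 2)) : ℕ))
              ∨ (a 4 = 1 ∧ 2 ≤ ((a 3 : Fin (d + 2)) : ℕ)))) →
        frameComp5 (brinkmannMat d H W gs) E x a = 0 := by
  intro x hx a ha
  set g := brinkmannMat d H W gs with hgdef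
  have hg : RegularMetric g U :=
    ⟨hU, smoothOn_brinkmannMat hHs hWs hgss, fun y hy => brinkmannMat_isSymm (hgsym y hy),
      fun y hy => isUnit_det_of_isLorentzMat (hlor y hy)⟩
  have hpar : ∀ y ∈ U, ∀ i k, connMat g i y k 1 = 0 := fun y _ i k =>
    connMat_brinkmannMat_col_one hHv hWv hgsv y i k
  let P : Matrix (Fin (d + 2)) (Fin (d + 2)) ℝ := Matrix.of fun m b => E b x m
  have hP : Pᵀ * g x * P = nullFrameGram d := by
    ext b c
    rw [← hframe x hx, Matrix.mul_assoc, Matrix.mul_apply, gApply]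
    refine Finset.sum_congr rfl fun k _ => ?_
    rw [Matrix.mul_apply, Finset.mul_sum]
    refine Finset.sum_congr rfl fun l _ => ?_
    simp only [P, Matrix.transpose_apply, Matrix.of_apply]
    ring
  have hP0 : ∀ m, m ≠ 1 → P m 0 = 0 := fun m hm => by
    obtain ⟨c, -, hc⟩ := hE0 x hx
    simp [P, hc, hm]
  have h0 : ∀ (idx : Fin 5 → Fin (d + 2)) (k : Fin 5), idx k = 0 →
      pullTensor P (covDeriv g (riemann g) x) idx = 0 := fun idx k hk =>
    pullTensor_eq_zero k 1 (fun m hm => by rw [hk, hP0 m hm])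
      fun μ hμ => covDeriv_riemann_eq_zero_of_parallel hg hpar hx hμ
  have ht := reducedCurvatureDerivative_frameNablaRiemann hg h2sym hx hP h0
  have hcomp : frameComp5 g E x a = pullTensor P (covDeriv g (riemann g) x) a := rfl
  rw [hcomp]
  by_cases hz : ∃ k, a k = 0
  · obtain ⟨k, hk⟩ := hz
    exact h0 a k hk
  have ha' : ∀ k, a k = 1 ∨ ∃ s : Fin d, a k = s.succ.succ := fun k =>
    (Fin.eq_zero_or_one_or_succ_succ (a k)).resolve_left fun hk => hz ⟨k, hk⟩
  have hidx : a = ![a 0, a 1, a 2, a 3, a 4] := by ext t; fin_cases t <;> rfl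
  rw [hidx]
  refine (ht.eq_zero_or (ha' 0) (ha' 1) (ha' 2) (ha' 3) (ha' 4)).resolve_right fun h => ha ?_
  have hval : ∀ k, (∃ s : Fin d, a k = s.succ.succ) → 2 ≤ (a k : ℕ) := by
    rintro k ⟨s, hs⟩
    simp [hs]
  exact ⟨h.1, h.2.1.imp (.imp_right (hval 2)) (.imp_right (hval 1)),
    h.2.2.imp (.imp_right (hval 4)) (.imp_right (hval 3))⟩
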